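/- Let a > 1 be an integer and b a nonnegative integer such that a + b is even, a + b ≥ 4, and a + 3b ≢ 0 (mod 8). Then the limit as n → ∞ of N*(a,b; 8n+a+3b) / N(a,b; 8n+a+3b) exists and equals 2 / (2^{a+b−2} + (−1)^b · 2^{(a+b−2)/2} · cos(π(a+3b)/4) + 1). -/

import Mathlib

/-- `N a b n` is the number of tuples `(x₁,…,x_a,y₁,…,y_b) ∈ ℤ^{a+b}` with
`n = x₁² + ⋯ + x_a² + 3y₁² + ⋯ + 3y_b²`. -/
noncomputable def N (a b : ℕ) (n : ℤ) : ℕ :=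
  Set.ncard {p : (Fin a → ℤ) × (Fin b → ℤ) |
    n = ∑ i, (p.1 i) ^ 2 + 3 * ∑ j, (p.2 j) ^ 2}

/-- `Nstar a b n` is the number of such tuples with all coordinates odd. -/
noncomputable def Nstar (a b : ℕ) (n : ℤ) : ℕ :=
  Set.ncard {p : (Fin a → ℤ) × (Fin b → ℤ) |
    (∀ i, Odd (p.1 i)) ∧ (∀ j, Odd (p.2 j)) ∧
    n = ∑ i, (p.1 i) ^ 2 + 3 * ∑ j, (p.2 j) ^ 2}

/-- The theta constants `(θ₂, θ₃, θ₄)` at `τ`, expressed through `jacobiTheta`. -/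
noncomputable def thetaVec (τ : ℂ) : Fin 3 → ℂ :=
  ![jacobiTheta (τ / 4) - jacobiTheta τ, jacobiTheta τ, jacobiTheta (τ + 1)]

lemma hasSum_jacobiTheta {τ : ℂ} (hτ : 0 < τ.im) :
    HasSum (fun n : ℤ => Complex.exp (Real.pi * Complex.I * (n : ℂ) ^ 2 * τ)) (jacobiTheta τ) := by
  have := hasSum_jacobiTheta₂_term 0 hτ
  simpa [jacobiTheta₂_term, ← jacobiTheta_eq_jacobiTheta₂] using this

lemma hasSum_jacobiTheta_even {τ : ℂ} (hτ : 0 < τ.im) :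
    HasSum (fun n : ℤ => if Even n then
      Complex.exp (Real.pi * Complex.I * (n : ℂ) ^ 2 * τ) else 0) (jacobiTheta (4 * τ)) := by
  have hinj : Function.Injective (fun n : ℤ => 2 * n) := fun m n h => by simpa using h
  rw [← hinj.hasSum_iff]
  · convert hasSum_jacobiTheta (τ := 4 * τ) (by simpa using hτ) using 2 with n
    simp only [Function.comp, even_two_mul, if_true]
    congr 1
    push_cast
    ring
  · intro x hx
    rw [if_neg]
    rintro ⟨k, rfl⟩
    exact hx ⟨k, by simp; ring⟩

lemma hasSum_thetaVec_zero {τ : ℂ} (hτ : 0 < τ.im) :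
    HasSum (fun n : ℤ => if Odd n then
      Complex.exp (Real.pi * Complex.I * (n : ℂ) ^ 2 * (τ / 4)) else 0) (thetaVec τ 0) := by
  have h4 : 0 < (τ / 4).im := by simpa using hτ
  have h := (hasSum_jacobiTheta h4).sub (hasSum_jacobiTheta_even h4)
  rw [mul_div_cancel₀ _ (by norm_num : (4 : ℂ) ≠ 0)] at h
  refine h.congr_fun ?_ 
  intro n
  rcases Int.even_or_odd n with hn | hn
  · simp [hn]
  · simp [hn, Int.not_even_iff_odd.mpr hn]

/-- The primitive eighth root of unity `exp (π i / 4)`. -/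
noncomputable def zeta8 : ℂ := Complex.exp (Real.pi * Complex.I / 4)

lemma zeta8_sq : zeta8 ^ 2 = Complex.I := by
  rw [zeta8, ← Complex.exp_nat_mul]
  nth_rw 2 [← Complex.exp_pi_div_two_mul_I]
  congr 1; push_cast; ring

lemma zeta8_pow_four : zeta8 ^ 4 = -1 := by
  linear_combination (zeta8 ^ 2 + Complex.I) * zeta8_sq + Complex.I_sq

lemma zeta8_pow_eight : zeta8 ^ 8 = 1 := by
  linear_combination (zeta8 ^ 4 - 1) * zeta8_pow_four

lemma norm_zeta8 : ‖zeta8‖ = 1 := by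
  rw [zeta8, show (Real.pi * Complex.I / 4 : ℂ) = ((Real.pi / 4 : ℝ) : ℂ) * Complex.I by
    push_cast; ring]
  exact Complex.norm_exp_ofReal_mul_I _

lemma thetaVec_add_one {τ : ℂ} (hτ : 0 < τ.im) :
    thetaVec (τ + 1) = ![zeta8 * thetaVec τ 0, thetaVec τ 2, thetaVec τ 1] := by
  ext i
  fin_cases i
  · have h1 := (hasSum_thetaVec_zero hτ).mul_left zeta8
    have h2 := hasSum_thetaVec_zero (τ := τ + 1) (by simpa using hτ)
    refine h2.unique (h1.congr_fun ?_)
    intro n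
    split_ifs with hn
    · obtain ⟨k, hk⟩ := Int.eight_dvd_sq_sub_one_of_odd hn
      have : (n : ℂ) ^ 2 = 8 * k + 1 := by
        have : n ^ 2 = 8 * k + 1 := by linarith
        exact_mod_cast this
      rw [zeta8, ← Complex.exp_add, this, Complex.exp_eq_exp_iff_exists_int]
      exact ⟨k, by ring⟩
    · simp
  · simp [thetaVec]
  · have := jacobiTheta_two_add τ
    simp only [thetaVec]
    simp
    rw [← this]; congr 1; ring

/-- `τ'` is related to `τ` as by the inversion, as far as theta constants are concerned. -/
def ThetaInv (τ τ' : ℂ) : Prop :=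
  ∃ s : ℂ, thetaVec τ' = ![s * thetaVec τ 2, s * thetaVec τ 1, s * thetaVec τ 0] ∧
    ‖s‖ ^ 4 * τ'.im = τ.im

lemma jacobiTheta_neg_inv {τ : ℂ} (hτ : 0 < τ.im) :
    jacobiTheta (-1 / τ) = (-Complex.I * τ) ^ (1 / 2 : ℂ) * jacobiTheta τ := by
  have := jacobiTheta_S_smul ⟨τ, hτ⟩
  rw [UpperHalfPlane.modular_S_smul] at this
  convert this using 2
  simp [neg_div]

lemma im_neg_inv {τ : ℂ} : (-1 / τ).im = τ.im / ‖τ‖ ^ 2 := by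
  rw [neg_div, one_div, Complex.neg_im, Complex.inv_im, Complex.normSq_eq_norm_sq]; ring

lemma im_neg_inv_pos {τ : ℂ} (hτ : 0 < τ.im) : 0 < (-1 / τ).im := by
  rw [im_neg_inv]
  have : τ ≠ 0 := by rintro rfl; simp at hτ
  positivity

lemma thetaVec_neg_inv_zero {τ : ℂ} (hτ : 0 < τ.im) :
    thetaVec (-1 / τ) 0 = (-Complex.I * τ) ^ (1 / 2 : ℂ) * thetaVec τ 2 := by
  have h0 : τ ≠ 0 := by rintro rfl; simp at hτ
  have h4 : 0 < (4 * τ).im := by simpa using hτ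
  have hs : HasSum (fun n : ℤ => Complex.exp (Real.pi * Complex.I * (n : ℂ) ^ 2 * τ) +
      Complex.exp (Real.pi * Complex.I * (n : ℂ) ^ 2 * (τ + 1)))
      (jacobiTheta τ + jacobiTheta (τ + 1)) :=
    (hasSum_jacobiTheta hτ).add (hasSum_jacobiTheta (by simpa using hτ))
  have he : jacobiTheta τ + jacobiTheta (τ + 1) = 2 * jacobiTheta (4 * τ) := by
    refine hs.unique (((hasSum_jacobiTheta_even hτ).mul_left 2).congr_fun ?_)
    intro n
    rw [mul_add, mul_one, Complex.exp_add]
    rcases Int.even_or_odd' n with ⟨k, rfl | rfl⟩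
    · have : Complex.exp (Real.pi * Complex.I * ((2 * k : ℤ) : ℂ) ^ 2) = 1 := by
        rw [Complex.exp_eq_one_iff]
        exact ⟨2 * k ^ 2, by push_cast; ring⟩
      rw [this]; simp; ring
    · have : Complex.exp (Real.pi * Complex.I * ((2 * k + 1 : ℤ) : ℂ) ^ 2) = -1 := by
        rw [← Complex.exp_pi_mul_I, Complex.exp_eq_exp_iff_exists_int]
        exact ⟨2 * k ^ 2 + 2 * k, by push_cast; ring⟩
      rw [this]
      have : ¬ Even (2 * k + 1) := by simp
      simp [this]
  have h1 := jacobiTheta_neg_inv hτ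
  have h2 := jacobiTheta_neg_inv h4
  have h3 : (-Complex.I * (4 * τ)) ^ (1 / 2 : ℂ) = 2 * (-Complex.I * τ) ^ (1 / 2 : ℂ) := by
    rw [show -Complex.I * (4 * τ) = ((4 : ℝ) : ℂ) * (-Complex.I * τ) by push_cast; ring,
      Complex.cpow_def_of_ne_zero (by simp [h0]), Complex.cpow_def_of_ne_zero (by simp [h0]),
      Complex.log_ofReal_mul (by norm_num) (by simp [h0]),
      show Real.log 4 = 2 * Real.log 2 by
        rw [show (4 : ℝ) = 2 ^ 2 by norm_num, Real.log_pow]; norm_num,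
      show ((((2 * Real.log 2 : ℝ) : ℂ) + Complex.log (-Complex.I * τ)) * (1 / 2) : ℂ) =
        (Real.log 2 : ℝ) + Complex.log (-Complex.I * τ) * (1 / 2) by push_cast; ring,
      Complex.exp_add, ← Complex.ofReal_exp, Real.exp_log (by norm_num)]
    norm_cast
  have h4 : -1 / τ / 4 = -1 / (4 * τ) := by rw [div_div, mul_comm]
  simp only [thetaVec, Matrix.cons_val]
  rw [h4, h2, h1, h3]
  linear_combination -(-Complex.I * τ) ^ (1 / 2 : ℂ) * he

lemma thetaInv_neg_inv {τ : ℂ} (hτ : 0 < τ.im) : ThetaInv τ (-1 / τ) := by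
  have h0 : τ ≠ 0 := by rintro rfl; simp at hτ
  have hre : 0 < (-Complex.I * τ).re := by simpa using hτ
  have hz : -Complex.I * τ ≠ 0 := by simp [h0]
  refine ⟨(-Complex.I * τ) ^ (1 / 2 : ℂ), ?_, ?_⟩
  · ext i
    fin_cases i
    · exact thetaVec_neg_inv_zero hτ
    · simpa [thetaVec] using jacobiTheta_neg_inv hτ
    · have h := thetaVec_neg_inv_zero (im_neg_inv_pos hτ)
      have e : -1 / (-1 / τ) = τ := by field_simp
      rw [e, show -Complex.I * (-1 / τ) = (-Complex.I * τ)⁻¹ by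
        rw [mul_inv, inv_neg, Complex.inv_I]; ring, Complex.inv_cpow] at h
      · have : (-Complex.I * τ) ^ (1 / 2 : ℂ) ≠ 0 := by simp [Complex.cpow_eq_zero_iff, h0]
        rw [h]
        field_simp
        rfl
      · intro h
        rw [Complex.arg_eq_pi_iff] at h
        linarith [h.1]
  · have : ((-Complex.I * τ) ^ (1 / 2 : ℂ)) ^ 2 = -Complex.I * τ := by
      rw [← Complex.cpow_nat_mul]; simp
    have h2 : ‖(-Complex.I * τ) ^ (1 / 2 : ℂ)‖ ^ 2 = ‖τ‖ := by
      rw [← norm_pow, this]; simp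
    rw [show 4 = 2 * 2 by rfl, pow_mul, h2, im_neg_inv]
    have : ‖τ‖ ≠ 0 := by simpa
    field_simp

/-- The sum of `(x + ζ⁻ˡ y) ^ a * (x' + ζ⁻³ˡ y') ^ b` over the classes `l` modulo `8` that are
congruent to `s` modulo `2`, where `ζ` is the primitive eighth root of unity `zeta8`. -/
noncomputable def thetaMix (a b s : ℕ) (x y x' y' : ℂ) : ℂ :=
  ∑ j ∈ Finset.range 4, (x + (zeta8⁻¹) ^ (2 * j + s) * y) ^ a *
    (x' + (zeta8⁻¹) ^ (3 * (2 * j + s)) * y') ^ b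

lemma zeta8_ne_zero : zeta8 ≠ 0 := Complex.exp_ne_zero _

lemma zeta8_inv_pow_eight : (zeta8⁻¹) ^ 8 = 1 := by rw [inv_pow, zeta8_pow_eight, inv_one]

lemma thetaMix_smul (a b s : ℕ) (c c' x y x' y' : ℂ) :
    thetaMix a b s (c * x) (c * y) (c' * x') (c' * y') =
      c ^ a * c' ^ b * thetaMix a b s x y x' y' := by
  rw [thetaMix, thetaMix, Finset.mul_sum]
  refine Finset.sum_congr rfl fun j _ => ?_
  rw [mul_mul_mul_comm, ← mul_pow, ← mul_pow]
  ring

lemma thetaMix_succ_right (a b s : ℕ) (x y x' y' : ℂ) :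
    thetaMix a b (s + 1) x (zeta8 * y) x' (zeta8 ^ 3 * y') = thetaMix a b s x y x' y' := by
  refine Finset.sum_congr rfl fun j _ => ?_
  have h0 := zeta8_ne_zero
  congr 2
  · rw [← add_assoc, pow_succ]; field_simp
  · rw [show 3 * (2 * j + (s + 1)) = 3 * (2 * j + s) + 3 by ring, pow_add]; field_simp

lemma thetaMix_add_two (a b s : ℕ) (x y x' y' : ℂ) :
    thetaMix a b (s + 2) x y x' y' = thetaMix a b s x y x' y' := by
  have h (j : ℕ) : 2 * j + (s + 2) = 2 * (j + 1) + s := by ring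
  simp only [thetaMix, h]
  rw [Finset.sum_range_succ, Finset.sum_range_succ' _ 3]
  congr 1
  rw [show 2 * (3 + 1) + s = 8 + (2 * 0 + s) by ring,
    show 3 * (8 + (2 * 0 + s)) = 8 * 3 + 3 * (2 * 0 + s) by ring, pow_add, pow_add _ (8 * 3),
    pow_mul _ 8, zeta8_inv_pow_eight, one_pow, one_mul, one_mul]

lemma thetaMix_zero_right (a b : ℕ) (x y x' y' : ℂ) :
    thetaMix a b 0 x (zeta8 * y) x' (zeta8 ^ 3 * y') = thetaMix a b 1 x y x' y' := by
  rw [← thetaMix_add_two]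
  exact thetaMix_succ_right a b 1 x y x' y'

lemma thetaMix_left (a b s : ℕ) (x y x' y' : ℂ) :
    thetaMix a b s (zeta8 * x) y (zeta8 ^ 3 * x') y' =
      zeta8 ^ (a + 3 * b) * thetaMix a b (s + 1) x y x' y' := by
  rw [← thetaMix_succ_right, thetaMix_smul]
  ring

/-- Three polynomials in two triples of theta constants, permuted up to constants by the
modular group. -/
noncomputable def thetaPoly (a b : ℕ) (κ : ℂ) (i : Fin 3) (v v' : Fin 3 → ℂ) : ℂ :=
  v i ^ a * v' i ^ b - κ *
    (![thetaMix a b 0 (v 0) (v 1) (v' 0) (v' 1) + thetaMix a b 1 (v 0) (v 2) (v' 0) (v' 2),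
      thetaMix a b 0 (v 1) (v 2) (v' 1) (v' 2) + thetaMix a b 0 (v 1) (v 0) (v' 1) (v' 0),
      thetaMix a b 0 (v 2) (v 1) (v' 2) (v' 1) + thetaMix a b 1 (v 2) (v 0) (v' 2) (v' 0)] i)

/-- The normalised total size of the three polynomials `thetaPoly` at a pair of points. -/
noncomputable def thetaSize (a b : ℕ) (κ τ σ : ℂ) : ℝ :=
  (∑ i, ‖thetaPoly a b κ i (thetaVec τ) (thetaVec σ)‖) * τ.im ^ (a / 4 : ℝ) * σ.im ^ (b / 4 : ℝ)

lemma thetaSize_inv (a b : ℕ) (κ : ℂ) {τ τ' σ σ' : ℂ} (hτ : 0 < τ'.im) (hσ : 0 < σ'.im)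
    (h : ThetaInv τ τ') (h' : ThetaInv σ σ') :
    thetaSize a b κ τ' σ' = thetaSize a b κ τ σ := by
  obtain ⟨s, hs, hs'⟩ := h
  obtain ⟨r, hr, hr'⟩ := h'
  have e (s : ℂ) (y : ℝ) (hy : 0 < y) (a : ℕ) :
      (‖s‖ ^ 4 * y) ^ (a / 4 : ℝ) = ‖s‖ ^ a * y ^ (a / 4 : ℝ) := by
    rw [Real.mul_rpow (by positivity) hy.le, ← Real.rpow_natCast_mul (norm_nonneg _)]
    congr 1
    rw [← Real.rpow_natCast]; congr 1; push_cast; ring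
  rw [thetaSize, thetaSize, ← hs', ← hr', e _ _ hτ, e _ _ hσ, hs, hr]
  simp only [Fin.sum_univ_three, thetaPoly, Matrix.cons_val, thetaMix_smul]
  have k (x y X Y κ c d : ℂ) (a b : ℕ) : ‖(c * x) ^ a * (d * y) ^ b -
      κ * (c ^ a * d ^ b * X + c ^ a * d ^ b * Y)‖ =
      ‖c‖ ^ a * ‖d‖ ^ b * ‖x ^ a * y ^ b - κ * (X + Y)‖ := by
    rw [← norm_pow, ← norm_pow, ← norm_mul, ← norm_mul]
    congr 1; ring
  simp only [k]
  rw [add_comm (thetaMix a b 0 (thetaVec τ 1) (thetaVec τ 0) _ _)]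
  ring

lemma thetaVec_add_three {τ : ℂ} (hτ : 0 < τ.im) :
    thetaVec (τ + 3) = ![zeta8 ^ 3 * thetaVec τ 0, thetaVec τ 2, thetaVec τ 1] := by
  have h1 : 0 < (τ + 1).im := by simpa using hτ
  have h2 : 0 < (τ + 1 + 1).im := by simpa using hτ
  rw [show τ + 3 = τ + 1 + 1 + 1 by ring, thetaVec_add_one h2, thetaVec_add_one h1,
    thetaVec_add_one hτ]
  ext i
  fin_cases i
  · simp; ring
  · simp
  · simp

lemma thetaVec_add_eight {τ : ℂ} (hτ : 0 < τ.im) : thetaVec (τ + 8) = thetaVec τ := by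
  have h1 : 0 < (τ + 3).im := by simpa using hτ
  have h2 : 0 < (τ + 3 + 3).im := by simpa using hτ
  have h3 : 0 < (τ + 3 + 3 + 1).im := by simpa using hτ
  rw [show τ + 8 = τ + 3 + 3 + 1 + 1 by ring, thetaVec_add_one h3, thetaVec_add_one h2,
    thetaVec_add_three h1, thetaVec_add_three hτ]
  ext i
  fin_cases i
  · simp
    linear_combination thetaVec τ 0 * zeta8_pow_eight
  · simp
  · simp

lemma thetaSize_add_eight (a b : ℕ) (κ : ℂ) {τ σ : ℂ} (hσ : 0 < σ.im) :
    thetaSize a b κ τ (σ + 8) = thetaSize a b κ τ σ := by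
  rw [thetaSize, thetaSize, thetaVec_add_eight hσ]
  simp

lemma thetaSize_add (a b : ℕ) (κ : ℂ) {τ σ : ℂ} (hτ : 0 < τ.im) (hσ : 0 < σ.im) :
    thetaSize a b κ (τ + 1) (σ + 3) = thetaSize a b κ τ σ := by
  rw [thetaSize, thetaSize, thetaVec_add_one hτ, thetaVec_add_three hσ]
  simp only [Fin.sum_univ_three, thetaPoly, Matrix.cons_val, thetaMix_left, thetaMix_zero_right]
  have h1 (x y x' y') : thetaMix a b 1 x (zeta8 * y) x' (zeta8 ^ 3 * y') =
    thetaMix a b 0 x y x' y' := thetaMix_succ_right a b 0 x y x' y'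
  have h2 (x y x' y') : thetaMix a b (1 + 1) x y x' y' =
    thetaMix a b 0 x y x' y' := thetaMix_add_two a b 0 x y x' y'
  rw [h1, h2]
  have k (x y X Y : ℂ) : ‖(zeta8 * x) ^ a * (zeta8 ^ 3 * y) ^ b -
      κ * (zeta8 ^ (a + 3 * b) * X + zeta8 ^ (a + 3 * b) * Y)‖ =
      ‖x ^ a * y ^ b - κ * (Y + X)‖ := by
    rw [← one_mul ‖x ^ a * y ^ b - κ * (Y + X)‖, ← one_pow (a + 3 * b), ← norm_zeta8,
      ← norm_pow, ← norm_mul]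
    congr 1; ring
  rw [k]
  simp only [Complex.add_im, Complex.one_im, Complex.im_ofNat, add_zero]
  ring

lemma ThetaInv.symm {τ τ' : ℂ} (hτ : 0 < τ.im) (h : ThetaInv τ τ') : ThetaInv τ' τ := by
  obtain ⟨s, hs, hs'⟩ := h
  have h0 : s ≠ 0 := by
    rintro rfl
    simp at hs'
    linarith
  refine ⟨s⁻¹, ?_, ?_⟩
  · rw [hs]
    ext i
    fin_cases i <;> simp [h0]
  · rw [← hs', norm_inv]
    have := norm_ne_zero_iff.mpr h0
    field_simp

lemma thetaInv_of_add {x : ℂ} (hx : 0 < x.im) :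
    ThetaInv x (-1 / (-1 / (x + 3) + 3) + 3) := by
  have h1 : 0 < (x + 3).im := by simpa using hx
  have h2 := im_neg_inv_pos h1
  have h3 : 0 < (-1 / (x + 3) + 3).im := by simpa using h2
  have h4 := im_neg_inv_pos h3
  obtain ⟨s, hs, hs'⟩ := thetaInv_neg_inv h1
  obtain ⟨r, hr, hr'⟩ := thetaInv_neg_inv h3
  refine ⟨zeta8 ^ 3 * s * r, ?_, ?_⟩
  · rw [thetaVec_add_three h4, hr, thetaVec_add_three h2, hs, thetaVec_add_three hx]
    ext i
    fin_cases i
    · simp; ring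
    · simp; ring
    · simp; ring
  · simp only [norm_mul, norm_pow, norm_zeta8, Complex.add_im, Complex.im_ofNat, add_zero] at *
    rw [← hs', ← hr']; ring

lemma thetaInv_third {τ : ℂ} (hτ : 0 < τ.im) : ThetaInv ((τ - 8) / 3) ((-1 / τ + 8) / 3) := by
  have h : 0 < ((τ - 8) / 3).im := by simpa using hτ
  have h0 : τ ≠ 0 := by rintro rfl; simp at hτ
  convert thetaInv_of_add h using 1
  have h1 : (τ - 8) / 3 + 3 ≠ 0 := by
    intro h'
    have : ((τ - 8) / 3 + 3).im = 0 := by rw [h']; rfl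
    simp at this
    linarith
  have h2 : -1 / ((τ - 8) / 3 + 3) + 3 ≠ 0 := by
    intro h'
    have h3 : 0 < ((τ - 8) / 3 + 3).im := by simpa using hτ
    have h4 := im_neg_inv_pos h3
    have : (-1 / ((τ - 8) / 3 + 3) + 3).im = 0 := by rw [h']; rfl
    rw [Complex.add_im, Complex.im_ofNat, add_zero] at this
    linarith
  have h3 : -1 / ((τ - 8) / 3 + 3) + 3 = 3 * τ / (τ + 1) := by
    have : τ + 1 ≠ 0 := fun h => h1 (by linear_combination h / 3)
    rw [show (τ - 8) / 3 + 3 = (τ + 1) / 3 by ring]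
    field_simp; ring
  rw [h3]
  have : τ + 1 ≠ 0 := fun h => h1 (by linear_combination h / 3)
  field_simp
  ring

/-- The sum of `thetaSize` over the four pairs `(τ, δ τ)` with `δ` of determinant `3`. -/
noncomputable def thetaTotal (a b : ℕ) (κ τ : ℂ) : ℝ :=
  thetaSize a b κ τ (3 * τ) + thetaSize a b κ τ (τ / 3) + thetaSize a b κ τ ((τ + 8) / 3) +
    thetaSize a b κ τ ((τ - 8) / 3)

lemma thetaTotal_add_one (a b : ℕ) (κ : ℂ) {τ : ℂ} (hτ : 0 < τ.im) :
    thetaTotal a b κ (τ + 1) = thetaTotal a b κ τ := by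
  have h1 : 0 < (3 * τ).im := by simpa using hτ
  have h2 : 0 < (τ / 3).im := by simpa using hτ
  have h3 : 0 < ((τ + 8) / 3).im := by simpa using hτ
  have h4 : 0 < ((τ - 8) / 3).im := by simpa using hτ
  have h5 : 0 < ((τ + 1 - 8) / 3).im := by simpa using hτ
  rw [thetaTotal, thetaTotal, ← thetaSize_add_eight a b κ h5, ← thetaSize_add a b κ hτ h1,
    ← thetaSize_add a b κ hτ h2, ← thetaSize_add a b κ hτ h3, ← thetaSize_add a b κ hτ h4,
    show 3 * (τ + 1) = 3 * τ + 3 by ring, show (τ + 1) / 3 = (τ - 8) / 3 + 3 by ring,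
    show (τ + 1 + 8) / 3 = τ / 3 + 3 by ring,
    show (τ + 1 - 8) / 3 + 8 = (τ + 8) / 3 + 3 by ring]
  ring

lemma thetaTotal_neg_inv (a b : ℕ) (κ : ℂ) {τ : ℂ} (hτ : 0 < τ.im) :
    thetaTotal a b κ (-1 / τ) = thetaTotal a b κ τ := by
  have h0 : τ ≠ 0 := by rintro rfl; simp at hτ
  have hi := im_neg_inv_pos hτ
  have h1 : 0 < (3 * τ).im := by simpa using hτ
  have h2 : 0 < (τ / 3).im := by simpa using hτ
  have h3 : 0 < ((τ + 8) / 3).im := by simpa using hτ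
  have k1 := thetaInv_neg_inv h1
  have k2 := thetaInv_neg_inv h2
  have k3 := thetaInv_third hτ
  have k4 := thetaInv_third hi
  rw [show -1 / (-1 / τ) = τ by field_simp] at k4
  have h5 : 0 < ((-1 / τ - 8) / 3).im := by simpa using hi
  have h6 : 0 < ((-1 / τ + 8) / 3).im := by simpa using hi
  replace k4 := k4.symm h5
  have k := thetaInv_neg_inv hτ
  rw [thetaTotal, thetaTotal, ← thetaSize_inv a b κ hi (im_neg_inv_pos h1) k k1,
    ← thetaSize_inv a b κ hi (im_neg_inv_pos h2) k k2, ← thetaSize_inv a b κ hi h6 k k3,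
    ← thetaSize_inv a b κ hi h5 k k4, show 3 * (-1 / τ) = -1 / (τ / 3) by field_simp,
    show -1 / τ / 3 = -1 / (3 * τ) by field_simp]
  ring

open scoped MatrixGroups in
lemma thetaTotal_smul (a b : ℕ) (κ : ℂ) (g : SL(2, ℤ)) (τ : UpperHalfPlane) :
    thetaTotal a b κ (g • τ : UpperHalfPlane) = thetaTotal a b κ τ := by
  have hg : g ∈ Subgroup.closure {ModularGroup.S, ModularGroup.T} := by
    simp [SpecialLinearGroup.SL2Z_generators]
  induction hg using Subgroup.closure_induction generalizing τ with
  | mem x hx =>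
    rcases hx with rfl | rfl
    · rw [UpperHalfPlane.modular_S_smul, ← thetaTotal_neg_inv a b κ τ.2]
      congr 1
      simp [neg_div]
    · rw [UpperHalfPlane.modular_T_smul, ← thetaTotal_add_one a b κ τ.2]
      congr 1
      simp [add_comm]
  | one => simp
  | mul x y _ _ hx hy => rw [mul_smul, hx, hy]
  | inv x _ hx => rw [← hx (x⁻¹ • τ), smul_inv_smul]

lemma zeta8_isPrimitiveRoot : IsPrimitiveRoot zeta8 8 := by
  have := Complex.isPrimitiveRoot_exp 8 (by norm_num)
  convert this using 1
  rw [zeta8]; congr 1; push_cast; ring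

lemma zeta8_inv_isPrimitiveRoot : IsPrimitiveRoot zeta8⁻¹ 8 := zeta8_isPrimitiveRoot.inv

lemma sqrt_two_mul_zeta8 : (Real.sqrt 2 : ℂ) * zeta8 = 1 + Complex.I := by
  rw [zeta8, show (Real.pi * Complex.I / 4 : ℂ) = ((Real.pi / 4 : ℝ) : ℂ) * Complex.I by
    push_cast; ring, Complex.exp_mul_I, ← Complex.ofReal_cos, ← Complex.ofReal_sin,
    Real.cos_pi_div_four, Real.sin_pi_div_four]
  have : (Real.sqrt 2 : ℂ) * Real.sqrt 2 = 2 := by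
    rw [← Complex.ofReal_mul, Real.mul_self_sqrt (by norm_num)]; simp
  push_cast
  linear_combination (1 + Complex.I) / 2 * this

lemma sqrt_two_mul_zeta8_inv : (Real.sqrt 2 : ℂ) * zeta8⁻¹ = 1 - Complex.I := by
  have h : zeta8⁻¹ = - Complex.I * zeta8 := by
    rw [inv_eq_iff_eq_inv, eq_comm, inv_eq_iff_eq_inv]
    refine eq_inv_of_mul_eq_one_left ?_
    linear_combination -Complex.I * zeta8_sq - Complex.I_sq
  rw [h]
  linear_combination -Complex.I * sqrt_two_mul_zeta8 - Complex.I_sq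

/-- The limiting ratio of the two representation numbers. -/
noncomputable def limitRatio (a b : ℕ) : ℝ :=
  2 / ((2 : ℝ) ^ (a + b - 2) +
    (-1 : ℝ) ^ b * 2 ^ ((a + b - 2) / 2) * Real.cos (Real.pi * (a + 3 * b) / 4) + 1)

lemma limitRatio_denom_pos {a b : ℕ} (hpar : Even (a + b)) (hge : 4 ≤ a + b) :
    0 < (2 : ℝ) ^ (a + b - 2) +
      (-1 : ℝ) ^ b * 2 ^ ((a + b - 2) / 2) * Real.cos (Real.pi * (a + 3 * b) / 4) + 1 := by
  obtain ⟨k, hk⟩ := hpar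
  rw [show a + b - 2 = (k - 1) * 2 by omega, Nat.mul_div_cancel _ (by norm_num), pow_mul]
  have h1 : |(-1 : ℝ) ^ b * Real.cos (Real.pi * (a + 3 * b) / 4)| ≤ 1 := by
    rw [abs_mul, abs_pow, abs_neg, abs_one, one_pow, one_mul]
    exact Real.abs_cos_le_one _
  have h2 := (abs_le.mp h1).1
  have h3 : (0 : ℝ) < 2 ^ (k - 1) := by positivity
  nlinarith [sq_nonneg ((2 : ℝ) ^ (k - 1) - 1)]

lemma cos_eq_zeta8 (a b : ℕ) : (-1 : ℂ) ^ b * Complex.cos (Real.pi * (a + 3 * b) / 4) =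
    (zeta8 ^ a * zeta8⁻¹ ^ b + zeta8⁻¹ ^ a * zeta8 ^ b) / 2 := by
  have h0 := zeta8_ne_zero
  have h4 (b : ℕ) : (zeta8 ^ b) ^ 4 = (-1) ^ b := by
    rw [← pow_mul, mul_comm, pow_mul, zeta8_pow_four]
  have e1 : Complex.exp (Real.pi * (a + 3 * b) / 4 * Complex.I) = zeta8 ^ (a + 3 * b) := by
    rw [zeta8, ← Complex.exp_nat_mul]; congr 1; push_cast; ring
  have e2 : Complex.exp (-(Real.pi * (a + 3 * b) / 4 : ℂ) * Complex.I) =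
      (zeta8 ^ (a + 3 * b))⁻¹ := by
    rw [← e1, ← Complex.exp_neg]; congr 1; ring
  rw [Complex.cos, e1, e2]
  have h5 : ((-1 : ℂ) ^ b) ^ 2 = 1 := by rw [← pow_mul, mul_comm, pow_mul]; simp
  rw [pow_add, mul_comm 3 b, pow_mul]
  have hb : zeta8 ^ b ≠ 0 := pow_ne_zero _ h0
  have ha : zeta8 ^ a ≠ 0 := pow_ne_zero _ h0
  rw [inv_pow, inv_pow]
  field_simp
  have h8 : (zeta8 ^ b) ^ 8 = 1 := by rw [← pow_mul, mul_comm, pow_mul, zeta8_pow_eight, one_pow]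
  rw [← h4]
  generalize zeta8 ^ b = x at *
  linear_combination (zeta8 ^ a) ^ 2 * x ^ 2 * h8

lemma limitRatio_mul {a b : ℕ} (hpar : Even (a + b)) (hge : 4 ≤ a + b) :
    (limitRatio a b / 8 : ℂ) * ((2 : ℂ) ^ (a + b) + (1 - Complex.I) ^ a * (1 + Complex.I) ^ b +
      (1 + Complex.I) ^ a * (1 - Complex.I) ^ b + 4) = 1 := by
  have hD := limitRatio_denom_pos hpar hge
  obtain ⟨k, hk⟩ := hpar
  have hs : (Real.sqrt 2 : ℂ) ^ (a + b) = 2 ^ k := by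
    rw [hk, ← two_mul, pow_mul, ← Complex.ofReal_pow, Real.sq_sqrt (by norm_num)]; simp
  have h1 : (1 - Complex.I) ^ a * (1 + Complex.I) ^ b +
      (1 + Complex.I) ^ a * (1 - Complex.I) ^ b =
      2 * 2 ^ k * ((-1 : ℂ) ^ b * Complex.cos (Real.pi * (a + 3 * b) / 4)) := by
    rw [cos_eq_zeta8, ← hs, ← sqrt_two_mul_zeta8, ← sqrt_two_mul_zeta8_inv]
    ring
  have h2 : ((2 : ℂ) ^ (a + b) + (1 - Complex.I) ^ a * (1 + Complex.I) ^ b +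
      (1 + Complex.I) ^ a * (1 - Complex.I) ^ b + 4) = 4 * (((2 : ℝ) ^ (a + b - 2) +
      (-1 : ℝ) ^ b * 2 ^ ((a + b - 2) / 2) * Real.cos (Real.pi * (a + 3 * b) / 4) + 1 : ℝ) : ℂ) := by
    rw [add_assoc (2 ^ (a + b)), h1]
    push_cast
    obtain ⟨j, rfl⟩ : ∃ j, k = j + 1 := ⟨k - 1, by omega⟩
    rw [hk, show j + 1 + (j + 1) - 2 = j * 2 by omega, Nat.mul_div_cancel _ (by norm_num)]
    ring
  rw [h2, limitRatio]
  have : ((((2 : ℝ) ^ (a + b - 2) +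
      (-1 : ℝ) ^ b * 2 ^ ((a + b - 2) / 2) * Real.cos (Real.pi * (a + 3 * b) / 4) + 1 : ℝ)) : ℂ) ≠ 0 :=
    Complex.ofReal_ne_zero.mpr hD.ne'
  rw [Complex.ofReal_div]
  field_simp
  norm_num

lemma thetaMix_one_one {a : ℕ} (ha : a ≠ 0) (b : ℕ) : thetaMix a b 0 1 1 1 1 =
    (2 : ℂ) ^ (a + b) + (1 - Complex.I) ^ a * (1 + Complex.I) ^ b +
      (1 + Complex.I) ^ a * (1 - Complex.I) ^ b := by
  have h2 : zeta8⁻¹ ^ 2 = -Complex.I := by rw [inv_pow, zeta8_sq, Complex.inv_I]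
  have h4 : zeta8⁻¹ ^ 4 = -1 := by rw [inv_pow, zeta8_pow_four]; norm_num
  have h6 : zeta8⁻¹ ^ 6 = Complex.I := by
    rw [show 6 = 4 + 2 by rfl, pow_add, h4, h2]; ring
  have h12 : zeta8⁻¹ ^ 12 = -1 := by
    rw [show 12 = 4 * 3 by rfl, pow_mul, h4]; norm_num
  have h18 : zeta8⁻¹ ^ 18 = -Complex.I := by
    rw [show 18 = 8 * 2 + 2 by rfl, pow_add, pow_mul, zeta8_inv_pow_eight, h2]; norm_num
  simp only [thetaMix, Finset.sum_range_succ, Finset.range_zero, Finset.sum_empty]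
  norm_num only [h2, h4, h6, h12, h18, zero_add, pow_zero, add_neg_cancel, zero_pow ha]
  ring

lemma thetaMix_one_zero (a b s : ℕ) : thetaMix a b s 1 0 1 0 = 4 := by
  simp [thetaMix]

lemma thetaMix_zero_one {a b : ℕ} (h : ¬ 8 ∣ a + 3 * b) :
    thetaMix a b 0 0 1 0 1 + thetaMix a b 1 0 1 0 1 = 0 := by
  have h1 : zeta8⁻¹ ^ (a + 3 * b) ≠ 1 := fun h' =>
    h (zeta8_inv_isPrimitiveRoot.dvd_of_pow_eq_one _ h')
  have h8 : (zeta8⁻¹ ^ (a + 3 * b)) ^ 8 = 1 := by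
    rw [← pow_mul, mul_comm, pow_mul, zeta8_inv_pow_eight, one_pow]
  have e (s j : ℕ) : (0 + zeta8⁻¹ ^ (2 * j + s) * 1) ^ a * (0 + zeta8⁻¹ ^ (3 * (2 * j + s)) * 1) ^ b
      = (zeta8⁻¹ ^ (a + 3 * b)) ^ (2 * j + s) := by
    rw [zero_add, mul_one, zero_add, mul_one, ← pow_mul, ← pow_mul, ← pow_mul, ← pow_add]
    congr 1; ring
  simp only [thetaMix, e]
  generalize zeta8⁻¹ ^ (a + 3 * b) = w at *
  have h2 := mul_geom_sum w 8
  rw [h8, sub_self] at h2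
  have h3 := (mul_eq_zero.mp h2).resolve_left (sub_ne_zero.mpr h1)
  simp only [Finset.sum_range_succ, Finset.range_zero, Finset.sum_empty] at h3 ⊢
  linear_combination h3

lemma thetaPoly_cusp {a b : ℕ} (ha : a ≠ 0) (hpar : Even (a + b)) (hge : 4 ≤ a + b)
    (hmod : ¬ 8 ∣ a + 3 * b) (i : Fin 3) :
    thetaPoly a b (limitRatio a b / 8 : ℂ) i ![0, 1, 1] ![0, 1, 1] = 0 := by
  have h := limitRatio_mul hpar hge
  fin_cases i
  · simp [thetaPoly, thetaMix_zero_one hmod, ha]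
  · simp only [thetaPoly, Fin.mk_one, Matrix.cons_val, thetaMix_one_one ha, thetaMix_one_zero,
      one_pow]
    linear_combination -h
  · simp only [thetaPoly, Fin.reduceFinMk, Matrix.cons_val, thetaMix_one_one ha,
      thetaMix_one_zero, one_pow]
    linear_combination -h

lemma norm_jacobiTheta_sub_one_le' {τ : ℂ} {δ : ℝ} (hδ : 0 < δ) (h : δ ≤ τ.im) :
    ‖jacobiTheta τ - 1‖ ≤ 2 / (1 - Real.exp (-Real.pi * δ)) * Real.exp (-Real.pi * τ.im) := by
  refine (norm_jacobiTheta_sub_one_le (hδ.trans_le h)).trans ?_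
  have : Real.exp (-Real.pi * δ) < 1 := by
    rw [Real.exp_lt_one_iff]; nlinarith [Real.pi_pos]
  have h2 : Real.exp (-Real.pi * τ.im) ≤ Real.exp (-Real.pi * δ) := by
    rw [Real.exp_le_exp]; nlinarith [Real.pi_pos]
  have : 0 < 1 - Real.exp (-Real.pi * δ) := by linarith
  gcongr

lemma exists_thetaVec_sub_le {δ : ℝ} (hδ : 0 < δ) : ∃ K, 0 < K ∧ ∀ τ : ℂ, δ ≤ τ.im →
    ‖thetaVec τ - ![0, 1, 1]‖ ≤ K * Real.exp (-(Real.pi / 4) * τ.im) := by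
  have hδ4 : 0 < δ / 4 := by linarith
  set A := 2 / (1 - Real.exp (-Real.pi * δ))
  set B := 2 / (1 - Real.exp (-Real.pi * (δ / 4)))
  have hpos {δ : ℝ} (hδ : 0 < δ) : 0 < 2 / (1 - Real.exp (-Real.pi * δ)) := by
    have : Real.exp (-Real.pi * δ) < 1 := by
      rw [Real.exp_lt_one_iff]; nlinarith [Real.pi_pos]
    have : 0 < 1 - Real.exp (-Real.pi * δ) := by linarith
    positivity
  have hA : 0 < A := hpos hδ
  have hB : 0 < B := hpos hδ4
  refine ⟨A + B, by positivity, fun τ hτ => ?_⟩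
  have h1 := norm_jacobiTheta_sub_one_le' hδ hτ
  have h2 : ‖jacobiTheta (τ + 1) - 1‖ ≤ A * Real.exp (-Real.pi * τ.im) := by
    have := norm_jacobiTheta_sub_one_le' (τ := τ + 1) hδ (by simpa using hτ)
    simpa only [Complex.add_im, Complex.one_im, add_zero] using this
  have h3 : ‖jacobiTheta (τ / 4) - 1‖ ≤ B * Real.exp (-(Real.pi / 4) * τ.im) := by
    have := norm_jacobiTheta_sub_one_le' (τ := τ / 4) hδ4 (by simp; linarith)
    refine this.trans_eq ?_
    congr 2
    simp; ring
  have h4 : Real.exp (-Real.pi * τ.im) ≤ Real.exp (-(Real.pi / 4) * τ.im) := by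
    rw [Real.exp_le_exp]; nlinarith [Real.pi_pos, mul_pos Real.pi_pos (hδ.trans_le hτ)]
  have h5 := mul_le_mul_of_nonneg_left h4 hA.le
  have h6 : 0 ≤ B * Real.exp (-(Real.pi / 4) * τ.im) := by positivity
  rw [pi_norm_le_iff_of_nonneg (by positivity), Fin.forall_fin_succ, Fin.forall_fin_two]
  simp only [thetaVec, Pi.sub_apply, Matrix.cons_val]
  refine ⟨?_, ?_, ?_⟩
  · have : jacobiTheta (τ / 4) - jacobiTheta τ - 0 =
      (jacobiTheta (τ / 4) - 1) - (jacobiTheta τ - 1) := by ring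
    simp only [this]
    refine (norm_sub_le _ _).trans ?_
    linarith
  · change ‖jacobiTheta τ - 1‖ ≤ _
    linarith
  · change ‖jacobiTheta (τ + 1) - 1‖ ≤ _
    linarith

lemma exists_thetaPoly_le {a b : ℕ} {κ : ℂ} (i : Fin 3)
    (h0 : thetaPoly a b κ i ![0, 1, 1] ![0, 1, 1] = 0) (K : ℝ) : ∃ L, 0 ≤ L ∧
    ∀ v v' : Fin 3 → ℂ, ‖v - ![0, 1, 1]‖ ≤ K → ‖v' - ![0, 1, 1]‖ ≤ K →
    ‖thetaPoly a b κ i v v'‖ ≤ L * max ‖v - ![0, 1, 1]‖ ‖v' - ![0, 1, 1]‖ := by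
  have hc : ContDiff ℝ 1 (fun p : (Fin 3 → ℂ) × (Fin 3 → ℂ) => thetaPoly a b κ i p.1 p.2) := by
    fin_cases i <;>
    · simp only [thetaPoly, thetaMix, Fin.zero_eta, Fin.mk_one, Fin.reduceFinMk, Matrix.cons_val]
      fun_prop
  set e : (Fin 3 → ℂ) × (Fin 3 → ℂ) := (![0, 1, 1], ![0, 1, 1])
  obtain ⟨L, hL⟩ := (hc.locallyLipschitz.locallyLipschitzOn
    (s := Metric.closedBall e K)).exists_lipschitzOnWith_of_compact
    (isCompact_closedBall e K)
  refine ⟨L, L.2, fun v v' hv hv' => ?_⟩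
  have hm : max ‖v - ![0, 1, 1]‖ ‖v' - ![0, 1, 1]‖ = dist (v, v') e := by
    rw [Prod.dist_eq, dist_eq_norm, dist_eq_norm]
  have h1 : (v, v') ∈ Metric.closedBall e K := by
    rw [Metric.mem_closedBall, ← hm]; exact max_le hv hv'
  have h2 : e ∈ Metric.closedBall e K := Metric.mem_closedBall_self
    ((norm_nonneg _).trans hv)
  have := hL.dist_le_mul _ h1 _ h2
  rw [hm]
  convert this using 1
  rw [dist_eq_norm, h0, sub_zero]

lemma rpow_le_exp {s c : ℝ} (hs : 0 < s) (hc : 0 < c) {y : ℝ} (hy : 0 < y) :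
    y ^ s ≤ (s / c) ^ s * Real.exp (c * y) := by
  have h := Real.add_one_le_exp (c / s * y)
  have h2 : y ≤ s / c * Real.exp (c / s * y) := by
    calc y = s / c * (c / s * y) := by field_simp
      _ ≤ _ := by gcongr; linarith
  refine (Real.rpow_le_rpow hy.le h2 hs.le).trans_eq ?_
  rw [Real.mul_rpow (by positivity) (Real.exp_pos _).le, ← Real.exp_mul]
  congr 2
  field_simp

lemma exists_thetaSize_le {a b : ℕ} {κ : ℂ} (ha : a ≠ 0)
    (h0 : ∀ i, thetaPoly a b κ i ![0, 1, 1] ![0, 1, 1] = 0) : ∃ M, ∀ τ σ : ℂ,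
    1 / 2 ≤ τ.im → τ.im / 3 ≤ σ.im → σ.im ≤ 3 * τ.im → thetaSize a b κ τ σ ≤ M := by
  obtain ⟨K, hK, hK'⟩ := exists_thetaVec_sub_le (δ := 1 / 6) (by norm_num)
  choose L hL0 hL using fun i => exists_thetaPoly_le i (h0 i) K
  set s : ℝ := a / 4 + b / 4
  have hs : 0 < s := by
    have : (0 : ℝ) < a := by positivity
    positivity
  set c : ℝ := Real.pi / 12
  have hc : 0 < c := by positivity
  refine ⟨(∑ i, L i * K) * (3 ^ (b / 4 : ℝ) * (s / c) ^ s), fun τ σ h1 h2 h3 => ?_⟩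
  have hy : 0 < τ.im := by linarith
  have hz : 0 < σ.im := by linarith
  set E := Real.exp (-c * τ.im)
  have e1 : ‖thetaVec τ - ![0, 1, 1]‖ ≤ K * E := by
    refine (hK' τ (by linarith)).trans ?_
    refine mul_le_mul_of_nonneg_left (Real.exp_le_exp.mpr ?_) hK.le
    simp only [c]
    nlinarith [mul_pos Real.pi_pos hy]
  have e2 : ‖thetaVec σ - ![0, 1, 1]‖ ≤ K * E := by
    refine (hK' σ (by linarith)).trans ?_
    refine mul_le_mul_of_nonneg_left (Real.exp_le_exp.mpr ?_) hK.le
    simp only [c]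
    nlinarith [mul_le_mul_of_nonneg_left h2 Real.pi_pos.le]
  have hE : K * E ≤ K := by
    refine mul_le_of_le_one_right hK.le ?_
    rw [Real.exp_le_one_iff]
    nlinarith
  have e3 : (∑ i, ‖thetaPoly a b κ i (thetaVec τ) (thetaVec σ)‖) ≤ (∑ i, L i * K) * E := by
    rw [Finset.sum_mul]
    refine Finset.sum_le_sum fun i _ => ?_
    refine (hL i _ _ (e1.trans hE) (e2.trans hE)).trans ?_
    rw [mul_assoc]
    exact mul_le_mul_of_nonneg_left (max_le e1 e2) (hL0 i)
  have e4 : σ.im ^ (b / 4 : ℝ) ≤ 3 ^ (b / 4 : ℝ) * τ.im ^ (b / 4 : ℝ) := by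
    rw [← Real.mul_rpow (by norm_num) hy.le]
    gcongr
  have e5 : τ.im ^ (a / 4 : ℝ) * σ.im ^ (b / 4 : ℝ) ≤
      3 ^ (b / 4 : ℝ) * ((s / c) ^ s * Real.exp (c * τ.im)) := by
    calc _ ≤ τ.im ^ (a / 4 : ℝ) * (3 ^ (b / 4 : ℝ) * τ.im ^ (b / 4 : ℝ)) := by gcongr
      _ = 3 ^ (b / 4 : ℝ) * τ.im ^ s := by rw [Real.rpow_add hy]; ring
      _ ≤ _ := by
        gcongr
        exact rpow_le_exp hs hc hy
  have hSL : 0 ≤ ∑ i, L i * K := Finset.sum_nonneg fun i _ => mul_nonneg (hL0 i) hK.le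
  rw [thetaSize, mul_assoc]
  calc _ ≤ (∑ i, L i * K) * E * (3 ^ (b / 4 : ℝ) * ((s / c) ^ s * Real.exp (c * τ.im))) := by
        gcongr
    _ = (∑ i, L i * K) * (3 ^ (b / 4 : ℝ) * (s / c) ^ s) * (E * Real.exp (c * τ.im)) := by ring
    _ = _ := by
      rw [← Real.exp_add]; simp

lemma thetaSize_nonneg {a b : ℕ} {κ τ σ : ℂ} (hτ : 0 < τ.im) (hσ : 0 < σ.im) :
    0 ≤ thetaSize a b κ τ σ := by
  rw [thetaSize]; positivity

lemma exists_thetaTotal_le {a b : ℕ} {κ : ℂ} (ha : a ≠ 0)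
    (h0 : ∀ i, thetaPoly a b κ i ![0, 1, 1] ![0, 1, 1] = 0) : ∃ M, ∀ τ : ℂ,
    0 < τ.im → thetaTotal a b κ τ ≤ M := by
  obtain ⟨M, hM⟩ := exists_thetaSize_le ha h0
  refine ⟨M + M + M + M, fun τ hτ => ?_⟩
  obtain ⟨g, hg⟩ := ModularGroup.exists_one_half_le_im_smul ⟨τ, hτ⟩
  have := thetaTotal_smul a b κ g ⟨τ, hτ⟩
  rw [show ((⟨τ, hτ⟩ : UpperHalfPlane) : ℂ) = τ from rfl] at this
  rw [← this]
  set z := g • (⟨τ, hτ⟩ : UpperHalfPlane)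
  have hz : 1 / 2 ≤ (z : ℂ).im := hg
  rw [thetaTotal]
  refine add_le_add (add_le_add (add_le_add (hM _ _ hz ?_ ?_) (hM _ _ hz ?_ ?_))
    (hM _ _ hz ?_ ?_)) (hM _ _ hz ?_ ?_) <;> simp [-UpperHalfPlane.coe_im] <;> linarith

lemma exists_thetaPoly_zero_le {a b : ℕ} {κ : ℂ} (ha : a ≠ 0)
    (h0 : ∀ i, thetaPoly a b κ i ![0, 1, 1] ![0, 1, 1] = 0) : ∃ M, ∀ τ : ℂ,
    0 < τ.im → ‖thetaPoly a b κ 0 (thetaVec τ) (thetaVec (3 * τ))‖ ≤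
      M * τ.im ^ (-((a + b : ℕ) / 4 : ℝ)) := by
  obtain ⟨M, hM⟩ := exists_thetaTotal_le ha h0
  refine ⟨M, fun τ hτ => ?_⟩
  have h1 : 0 < (3 * τ).im := by simpa using hτ
  have h2 : 0 < (τ / 3).im := by simpa using hτ
  have h3 : 0 < ((τ + 8) / 3).im := by simpa using hτ
  have h4 : 0 < ((τ - 8) / 3).im := by simpa using hτ
  have h5 := hM τ hτ
  rw [thetaTotal] at h5
  have h6 : thetaSize a b κ τ (3 * τ) ≤ M := by
    linarith [thetaSize_nonneg (a := a) (b := b) (κ := κ) hτ h2,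
      thetaSize_nonneg (a := a) (b := b) (κ := κ) hτ h3,
      thetaSize_nonneg (a := a) (b := b) (κ := κ) hτ h4]
  rw [Real.rpow_neg hτ.le, ← div_eq_mul_inv, le_div_iff₀ (by positivity)]
  refine le_trans ?_ h6
  rw [thetaSize, mul_assoc]
  gcongr
  · exact Finset.single_le_sum (f := fun i => ‖thetaPoly a b κ i (thetaVec τ) (thetaVec (3 * τ))‖)
      (fun i _ => norm_nonneg _) (Finset.mem_univ 0)
  · push_cast
    rw [add_div, Real.rpow_add hτ]
    gcongr
    simp only [Complex.mul_im, Complex.re_ofNat, Complex.im_ofNat]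
    linarith

/-- The quadratic form `x₁² + ⋯ + x_a² + 3y₁² + ⋯ + 3y_b²`. -/
def quadForm (a b : ℕ) (p : (Fin a → ℤ) × (Fin b → ℤ)) : ℤ :=
  ∑ i, (p.1 i) ^ 2 + 3 * ∑ j, (p.2 j) ^ 2

lemma hasSum_prod_fin {f : ℤ → ℂ} {s : ℂ} (hf : HasSum f s) (a : ℕ) :
    HasSum (fun x : Fin a → ℤ => ∏ i, f (x i)) (s ^ a) := by
  induction a with
  | zero => simp [hasSum_unique]
  | succ a ih =>
    rw [← (Fin.consEquiv fun _ => ℤ).hasSum_iff]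
    have h1 : Summable fun p : ℤ × (Fin a → ℤ) => f p.1 * ∏ i, f (p.2 i) :=
      summable_mul_of_summable_norm (f := f) (g := fun x : Fin a → ℤ => ∏ i, f (x i))
        hf.summable.norm ih.summable.norm
    have h := hf.mul ih h1
    rw [pow_succ']
    refine h.congr_fun fun p => ?_
    simp [Fin.consEquiv, Fin.prod_univ_succ]

lemma hasSum_prod_form {f g : ℤ → ℂ} {s t : ℂ} (hf : HasSum f s) (hg : HasSum g t) (a b : ℕ) :
    HasSum (fun p : (Fin a → ℤ) × (Fin b → ℤ) => (∏ i, f (p.1 i)) * ∏ j, g (p.2 j))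
      (s ^ a * t ^ b) := by
  have h1 : Summable fun p : (Fin a → ℤ) × (Fin b → ℤ) => (∏ i, f (p.1 i)) * ∏ j, g (p.2 j) :=
    summable_mul_of_summable_norm (f := fun x : Fin a → ℤ => ∏ i, f (x i))
      (g := fun x : Fin b → ℤ => ∏ j, g (x j)) (hasSum_prod_fin hf a).summable.norm
      (hasSum_prod_fin hg b).summable.norm
  have h2 := HasSum.mul (f := fun x : Fin a → ℤ => ∏ i, f (x i))
    (g := fun x : Fin b → ℤ => ∏ j, g (x j)) (hasSum_prod_fin hf a) (hasSum_prod_fin hg b) h1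
  exact h2

lemma prod_exp_eq (a b : ℕ) (c : ℂ) (p : (Fin a → ℤ) × (Fin b → ℤ)) :
    (∏ i, Complex.exp (Real.pi * Complex.I * (p.1 i : ℂ) ^ 2 * c)) *
      ∏ j, Complex.exp (Real.pi * Complex.I * (p.2 j : ℂ) ^ 2 * (3 * c)) =
    Complex.exp (Real.pi * Complex.I * quadForm a b p * c) := by
  rw [← Complex.exp_sum, ← Complex.exp_sum, ← Complex.exp_add, quadForm]
  congr 1
  push_cast
  simp only [Finset.mul_sum, Finset.sum_mul, mul_add, add_mul]
  congr 1
  refine Finset.sum_congr rfl fun j _ => by ring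

lemma hasSum_theta_form (a b : ℕ) {τ : ℂ} (hτ : 0 < τ.im) :
    HasSum (fun p => Complex.exp (Real.pi * Complex.I * quadForm a b p * τ))
      (jacobiTheta τ ^ a * jacobiTheta (3 * τ) ^ b) := by
  have h3 : 0 < (3 * τ).im := by simpa using hτ
  exact (hasSum_prod_form (hasSum_jacobiTheta hτ) (hasSum_jacobiTheta h3) a b).congr_fun
    fun p => (prod_exp_eq a b τ p).symm

open Classical in
lemma hasSum_theta_odd_form (a b : ℕ) {τ : ℂ} (hτ : 0 < τ.im) :
    HasSum (fun p : (Fin a → ℤ) × (Fin b → ℤ) =>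
      (if (∀ i, Odd (p.1 i)) ∧ ∀ j, Odd (p.2 j) then 1 else 0) *
        Complex.exp (Real.pi * Complex.I * quadForm a b p * (τ / 4)))
      (thetaVec τ 0 ^ a * thetaVec (3 * τ) 0 ^ b) := by
  have h3 : 0 < (3 * τ).im := by simpa using hτ
  refine (hasSum_prod_form (hasSum_thetaVec_zero hτ) (hasSum_thetaVec_zero h3) a b).congr_fun
    fun p => ?_
  rw [Finset.prod_ite_zero, Finset.prod_ite_zero, mul_div_assoc, ← prod_exp_eq]
  simp only [Finset.mem_univ, true_imp_iff]
  by_cases h1 : ∀ i, Odd (p.1 i) <;> by_cases h2 : ∀ j, Odd (p.2 j) <;>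
    simp only [h1, h2, if_true, if_false, and_true, and_false, mul_zero,
      zero_mul, one_mul, implies_true]

lemma thetaVec_add_nat {τ : ℂ} (hτ : 0 < τ.im) (l : ℕ) : thetaVec (τ + l) =
    ![zeta8 ^ l * thetaVec τ 0, if Even l then thetaVec τ 1 else thetaVec τ 2,
      if Even l then thetaVec τ 2 else thetaVec τ 1] := by
  induction l with
  | zero =>
    ext i
    fin_cases i <;> simp
  | succ l ih =>
    have h : 0 < (τ + l).im := by simpa using hτ
    rw [Nat.cast_succ, ← add_assoc, thetaVec_add_one h, ih]
    by_cases hl : Even l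
    · ext i
      fin_cases i <;> simp [hl, Nat.even_add_one]
      ring
    · ext i
      fin_cases i <;> simp [hl, Nat.even_add_one]
      ring

lemma thetaMix_term {τ : ℂ} (hτ : 0 < τ.im) (a b l : ℕ) (i : Fin 3)
    (hi : i = if Even l then 1 else 2) :
    (thetaVec τ 0 + zeta8⁻¹ ^ l * thetaVec τ i) ^ a *
      (thetaVec (3 * τ) 0 + zeta8⁻¹ ^ (3 * l) * thetaVec (3 * τ) i) ^ b =
    zeta8⁻¹ ^ (l * (a + 3 * b)) *
      (jacobiTheta ((τ + l) / 4) ^ a * jacobiTheta (3 * ((τ + l) / 4)) ^ b) := by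
  have h3 : 0 < (3 * τ).im := by simpa using hτ
  have key {τ : ℂ} : jacobiTheta (τ / 4) = thetaVec τ 0 + thetaVec τ 1 := by simp [thetaVec]
  have hz := zeta8_ne_zero
  have k1 : thetaVec τ 0 + zeta8⁻¹ ^ l * thetaVec τ i =
      zeta8⁻¹ ^ l * jacobiTheta ((τ + l) / 4) := by
    rw [key, thetaVec_add_nat hτ]
    have : zeta8⁻¹ ^ l * zeta8 ^ l = 1 := by rw [← mul_pow, inv_mul_cancel₀ hz, one_pow]
    subst hi
    simp only [Matrix.cons_val]
    split_ifs <;> linear_combination -thetaVec τ 0 * this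
  have k2 : thetaVec (3 * τ) 0 + zeta8⁻¹ ^ (3 * l) * thetaVec (3 * τ) i =
      zeta8⁻¹ ^ (3 * l) * jacobiTheta (3 * ((τ + l) / 4)) := by
    rw [show 3 * ((τ + l) / 4) = (3 * τ + (3 * l : ℕ)) / 4 by push_cast; ring, key,
      thetaVec_add_nat h3]
    have : zeta8⁻¹ ^ (3 * l) * zeta8 ^ (3 * l) = 1 := by
      rw [← mul_pow, inv_mul_cancel₀ hz, one_pow]
    have he : Even (3 * l) ↔ Even l := by
      simp [Nat.even_mul, show ¬ Even 3 by decide]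
    subst hi
    simp only [Matrix.cons_val, he]
    split_ifs <;> linear_combination -thetaVec (3 * τ) 0 * this
  rw [k1, k2, mul_pow, mul_pow, ← pow_mul, ← pow_mul]
  ring

lemma sum_range_eight {M : Type*} [AddCommMonoid M] (f : ℕ → M) :
    ∑ l ∈ Finset.range 8, f l =
      ∑ j ∈ Finset.range 4, f (2 * j + 0) + ∑ j ∈ Finset.range 4, f (2 * j + 1) := by
  simp only [Finset.sum_range_succ, Finset.range_zero, Finset.sum_empty]
  norm_num
  abel

/-- The coefficients of the generating function `thetaPoly a b κ 0`. -/
noncomputable def thetaCoeff (a b : ℕ) (κ : ℂ) (p : (Fin a → ℤ) × (Fin b → ℤ)) : ℂ :=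
  open Classical in
  (if (∀ i, Odd (p.1 i)) ∧ ∀ j, Odd (p.2 j) then 1 else 0) -
    κ * ∑ l ∈ Finset.range 8, (zeta8 ^ (quadForm a b p - (a + 3 * b : ℕ))) ^ l

lemma norm_thetaCoeff_le (a b : ℕ) (κ : ℂ) (p : (Fin a → ℤ) × (Fin b → ℤ)) :
    ‖thetaCoeff a b κ p‖ ≤ 1 + ‖κ‖ * 8 := by
  refine (norm_sub_le _ _).trans (add_le_add ?_ ?_)
  · split_ifs <;> simp
  · rw [norm_mul]
    gcongr
    refine (norm_sum_le _ _).trans ?_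
    simp [norm_zeta8]

lemma thetaCoeff_of_dvd {a b : ℕ} (κ : ℂ) {p : (Fin a → ℤ) × (Fin b → ℤ)}
    (h : 8 ∣ quadForm a b p - (a + 3 * b : ℕ)) : thetaCoeff a b κ p =
      open Classical in
      (if (∀ i, Odd (p.1 i)) ∧ ∀ j, Odd (p.2 j) then 1 else 0) - κ * 8 := by
  obtain ⟨k, hk⟩ := h
  have : zeta8 ^ (quadForm a b p - (a + 3 * b : ℕ)) = 1 := by
    rw [hk, zpow_mul]
    have : zeta8 ^ (8 : ℤ) = 1 := by exact_mod_cast zeta8_pow_eight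
    rw [this, one_zpow]
  rw [thetaCoeff, this]
  simp

lemma hasSum_thetaPoly (a b : ℕ) (κ : ℂ) {τ : ℂ} (hτ : 0 < τ.im) :
    HasSum (fun p => thetaCoeff a b κ p *
        Complex.exp (Real.pi * Complex.I * quadForm a b p * (τ / 4)))
      (thetaPoly a b κ 0 (thetaVec τ) (thetaVec (3 * τ))) := by
  have hl (l : ℕ) : HasSum (fun p => (zeta8 ^ (quadForm a b p - (a + 3 * b : ℕ))) ^ l *
      Complex.exp (Real.pi * Complex.I * quadForm a b p * (τ / 4)))
      (zeta8⁻¹ ^ (l * (a + 3 * b)) *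
        (jacobiTheta ((τ + l) / 4) ^ a * jacobiTheta (3 * ((τ + l) / 4)) ^ b)) := by
    have h4 : 0 < ((τ + l) / 4).im := by simpa using hτ
    refine ((hasSum_theta_form a b h4).mul_left _).congr_fun fun p => ?_
    rw [show Real.pi * Complex.I * quadForm a b p * ((τ + l) / 4) =
      Real.pi * Complex.I * quadForm a b p * (τ / 4) +
      (quadForm a b p * l : ℤ) * (Real.pi * Complex.I / 4) by push_cast; ring, Complex.exp_add,
      Complex.exp_int_mul, ← zeta8, zpow_sub₀ zeta8_ne_zero, div_pow, zpow_mul, zpow_natCast,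
      zpow_natCast, ← pow_mul, mul_comm (a + 3 * b) l, inv_pow]
    field_simp
  have h := (hasSum_theta_odd_form a b hτ).sub
    ((hasSum_sum fun l (_ : l ∈ Finset.range 8) => hl l).mul_left κ)
  have hv : thetaPoly a b κ 0 (thetaVec τ) (thetaVec (3 * τ)) =
      thetaVec τ 0 ^ a * thetaVec (3 * τ) 0 ^ b - κ * ∑ l ∈ Finset.range 8,
        zeta8⁻¹ ^ (l * (a + 3 * b)) *
        (jacobiTheta ((τ + l) / 4) ^ a * jacobiTheta (3 * ((τ + l) / 4)) ^ b) := by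
    rw [thetaPoly, sum_range_eight]
    simp only [Matrix.cons_val_zero, thetaMix]
    congr 3
    · refine Finset.sum_congr rfl fun j _ => ?_
      rw [← thetaMix_term hτ a b (2 * j + 0) 1 (by simp)]
    · refine Finset.sum_congr rfl fun j _ => ?_
      rw [← thetaMix_term hτ a b (2 * j + 1) 2 (by simp)]
  rw [hv]
  refine h.congr_fun fun p => ?_
  rw [thetaCoeff, sub_mul, mul_assoc κ, Finset.sum_mul]

lemma quadForm_nonneg (a b : ℕ) (p : (Fin a → ℤ) × (Fin b → ℤ)) : 0 ≤ quadForm a b p := by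
  rw [quadForm]; positivity

lemma norm_exp_form (m : ℤ) (τ : ℂ) : ‖Complex.exp (Real.pi * Complex.I * m * (τ / 4))‖ =
    Real.exp (-(Real.pi * m * τ.im / 4)) := by
  rw [Complex.norm_exp]
  congr 1
  rw [show (Real.pi * Complex.I * m * (τ / 4) : ℂ) =
    ((Real.pi * m / 4 : ℝ) : ℂ) * (Complex.I * τ) by push_cast; ring, Complex.re_ofReal_mul]
  simp
  ring

lemma integral_exp_period (m : ℤ) :
    ∫ x : ℝ in (0 : ℝ)..8, Complex.exp (Real.pi * Complex.I * m * ((x : ℂ) / 4)) =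
      if m = 0 then 8 else 0 := by
  split_ifs with h
  · simp [h]
  · have hc : (Real.pi * Complex.I * m / 4 : ℂ) ≠ 0 := by
      have := Real.pi_ne_zero
      simp [h, this]
    have := integral_exp_mul_complex (a := 0) (b := 8) hc
    rw [show (fun x : ℝ => Complex.exp (Real.pi * Complex.I * m * ((x : ℂ) / 4))) =
      fun x : ℝ => Complex.exp (Real.pi * Complex.I * m / 4 * x) by ext x; congr 1; ring, this]
    have h1 : Complex.exp (Real.pi * Complex.I * m / 4 * (8 : ℝ)) = 1 := by
      rw [Complex.exp_eq_one_iff]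
      exact ⟨m, by push_cast; ring⟩
    rw [h1, Complex.ofReal_zero, mul_zero, Complex.exp_zero, sub_self, zero_div]

/-- Coefficients of a series in `exp (π i τ / 4)` are bounded by the values of the series on a
horizontal line. -/
lemma norm_coeff_le {ι : Type*} [Countable ι] {c : ι → ℂ} {q : ι → ℤ} {F : ℂ → ℂ} {C y B : ℝ}
    (hc : ∀ p, ‖c p‖ ≤ C)
    (hq : Summable fun p => Real.exp (-(Real.pi * q p * y / 4)))
    (hF : ∀ τ : ℂ, τ.im = y →
      HasSum (fun p => c p * Complex.exp (Real.pi * Complex.I * q p * (τ / 4))) (F τ))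
    (hB : ∀ τ : ℂ, τ.im = y → ‖F τ‖ ≤ B) (m : ℤ) :
    ‖∑' p, if q p = m then c p else 0‖ ≤ B * Real.exp (Real.pi * m * y / 4) := by
  set w : ℝ → ℂ := fun x => x + y * Complex.I
  have hw (x : ℝ) : (w x).im = y := by simp [w]
  set g : ι → ℝ → ℂ := fun p x => c p * Complex.exp (Real.pi * Complex.I * q p * (w x / 4)) *
    Complex.exp (Real.pi * Complex.I * (-m : ℤ) * (w x / 4))
  have hasSum_int : HasSum (fun p => ∫ x in (0 : ℝ)..8, g p x)
      (∫ x in (0 : ℝ)..8, F (w x) * Complex.exp (Real.pi * Complex.I * (-m : ℤ) * (w x / 4))) := by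
    refine intervalIntegral.hasSum_integral_of_dominated_convergence
      (fun p _ => C * Real.exp (-(Real.pi * q p * y / 4)) * Real.exp (Real.pi * m * y / 4))
      (fun p => ?_) (fun p => ?_) ?_ ?_ ?_
    · refine Continuous.aestronglyMeasurable ?_
      simp only [g, w]
      fun_prop
    · refine Filter.Eventually.of_forall fun x _ => ?_
      simp only [g]
      rw [norm_mul, norm_mul, norm_exp_form, norm_exp_form, hw]
      push_cast
      rw [show -(Real.pi * -(m : ℝ) * y / 4) = Real.pi * m * y / 4 by ring]
      gcongr
      exact hc p
    · exact Filter.Eventually.of_forall fun x _ => (hq.mul_left C).mul_right _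
    · exact intervalIntegrable_const
    · exact Filter.Eventually.of_forall fun x _ => (hF _ (hw x)).mul_right _
  have hg (p : ι) : ∫ x in (0 : ℝ)..8, g p x = 8 * (if q p = m then c p else 0) := by
    have h1 : g p = fun x : ℝ => c p * Complex.exp (Real.pi * Complex.I * (q p - m : ℤ) *
        (y * Complex.I / 4)) * Complex.exp (Real.pi * Complex.I * (q p - m : ℤ) * ((x : ℂ) / 4)) := by
      ext x
      simp only [g, w, mul_assoc]
      rw [← Complex.exp_add, ← Complex.exp_add]
      congr 2
      push_cast
      ring
    rw [h1, intervalIntegral.integral_const_mul, integral_exp_period]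
    by_cases h : q p = m
    · simp [h]; ring
    · simp [h, sub_eq_zero]
  simp only [hg] at hasSum_int
  have h2 := hasSum_int.tsum_eq
  rw [tsum_mul_left] at h2
  have h3 : ‖∫ x in (0 : ℝ)..8, F (w x) * Complex.exp (Real.pi * Complex.I * (-m : ℤ) *
      (w x / 4))‖ ≤ B * Real.exp (Real.pi * m * y / 4) * |8 - 0| := by
    refine intervalIntegral.norm_integral_le_of_norm_le_const fun x _ => ?_
    rw [norm_mul, norm_exp_form, hw]
    push_cast
    rw [show -(Real.pi * -(m : ℝ) * y / 4) = Real.pi * m * y / 4 by ring]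
    gcongr
    exact hB _ (hw x)
  rw [← h2, norm_mul] at h3
  norm_num at h3
  linarith

lemma finite_quadForm_eq (a b : ℕ) (m : ℤ) : {p | quadForm a b p = m}.Finite := by
  have h (p) (hp : quadForm a b p = m) : (∀ i, |p.1 i| ≤ |m|) ∧ ∀ j, |p.2 j| ≤ |m| := by
    rw [← hp, abs_of_nonneg (quadForm_nonneg a b p), quadForm]
    have h1 : ∀ z : ℤ, |z| ≤ z ^ 2 := fun z => by
      rw [← sq_abs]; exact Int.le_self_sq _
    have hA : 0 ≤ ∑ i, (p.1 i) ^ 2 := by positivity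
    have hB : 0 ≤ ∑ i, (p.2 i) ^ 2 := by positivity
    refine ⟨fun i => ?_, fun j => ?_⟩
    · have := Finset.single_le_sum (f := fun i => (p.1 i) ^ 2) (fun i _ => sq_nonneg _)
        (Finset.mem_univ i)
      linarith [h1 (p.1 i)]
    · have := Finset.single_le_sum (f := fun i => (p.2 i) ^ 2) (fun i _ => sq_nonneg _)
        (Finset.mem_univ j)
      linarith [h1 (p.2 j)]
  refine Set.Finite.subset ((Set.finite_Icc (fun _ : Fin a => -|m|) (fun _ => |m|)).prod
    (Set.finite_Icc (fun _ : Fin b => -|m|) (fun _ => |m|))) fun p hp => ?_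
  obtain ⟨h1, h2⟩ := h p hp
  exact ⟨⟨fun i => (abs_le.mp (h1 i)).1, fun i => (abs_le.mp (h1 i)).2⟩,
    ⟨fun i => (abs_le.mp (h2 i)).1, fun i => (abs_le.mp (h2 i)).2⟩⟩

lemma N_eq_ncard (a b : ℕ) (m : ℤ) : N a b m = {p | quadForm a b p = m}.ncard := by
  simp only [N, quadForm, eq_comm]

lemma Nstar_eq_ncard (a b : ℕ) (m : ℤ) : Nstar a b m =
    {p : (Fin a → ℤ) × (Fin b → ℤ) | ((∀ i, Odd (p.1 i)) ∧ ∀ j, Odd (p.2 j)) ∧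
      quadForm a b p = m}.ncard := by
  simp only [Nstar, quadForm, and_assoc, @eq_comm _ _ m]

lemma Nstar_le_N (a b : ℕ) (m : ℤ) : Nstar a b m ≤ N a b m := by
  rw [N_eq_ncard, Nstar_eq_ncard]
  exact Set.ncard_le_ncard (fun p hp => hp.2) (finite_quadForm_eq a b m)

lemma tsum_thetaCoeff {a b : ℕ} {m : ℤ} (h : 8 ∣ m - (a + 3 * b : ℕ)) (c : ℂ) :
    (∑' p, if quadForm a b p = m then thetaCoeff a b (c / 8) p else 0) =
      Nstar a b m - c * N a b m := by
  classical
  have hf := finite_quadForm_eq a b m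
  rw [tsum_eq_sum (s := hf.toFinset) fun p hp => if_neg (by simpa using hp)]
  have h1 : ∀ p ∈ hf.toFinset, (if quadForm a b p = m then thetaCoeff a b (c / 8) p else 0) =
      (if (∀ i, Odd (p.1 i)) ∧ ∀ j, Odd (p.2 j) then 1 else 0) - c := by
    intro p hp
    have hp : quadForm a b p = m := by simpa using hp
    rw [if_pos hp, thetaCoeff_of_dvd _ (by rwa [hp])]
    congr 1
    ring
  rw [Finset.sum_congr rfl h1, Finset.sum_sub_distrib, Finset.sum_const, nsmul_eq_mul,
    Finset.sum_boole, N_eq_ncard, Nstar_eq_ncard, ← Set.ncard_eq_toFinset_card _ hf, mul_comm c]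
  congr 2
  rw [← Set.ncard_coe_finset]
  congr 1
  ext p
  simp [and_comm]

lemma exists_abs_Nstar_sub_le {a b : ℕ} (ha : a ≠ 0) (hpar : Even (a + b)) (hge : 4 ≤ a + b)
    (hmod : ¬ 8 ∣ a + 3 * b) : ∃ M : ℝ, ∀ m : ℤ, 0 < m → 8 ∣ m - (a + 3 * b : ℕ) →
    |(Nstar a b m : ℝ) - limitRatio a b * N a b m| ≤ M * (m : ℝ) ^ ((a + b : ℕ) / 4 : ℝ) := by
  obtain ⟨M, hM⟩ := exists_thetaPoly_zero_le (κ := (limitRatio a b / 8 : ℂ)) ha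
    (thetaPoly_cusp ha hpar hge hmod)
  refine ⟨M * Real.exp (Real.pi / 4), fun m hm h8 => ?_⟩
  have hm' : (0 : ℝ) < m := by exact_mod_cast hm
  set y : ℝ := 1 / m
  have hy : 0 < y := by positivity
  have hq : Summable fun p => Real.exp (-(Real.pi * quadForm a b p * y / 4)) := by
    have := (hasSum_theta_form a b (τ := y * Complex.I / 4) (by simpa using hy)).summable.norm
    refine this.congr fun p => ?_
    rw [show (Real.pi * Complex.I * quadForm a b p * (y * Complex.I / 4) : ℂ) =
      Real.pi * Complex.I * quadForm a b p * ((y * Complex.I) / 4) by ring, norm_exp_form]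
    simp
  have := norm_coeff_le (norm_thetaCoeff_le a b (limitRatio a b / 8 : ℂ)) hq
    (F := fun τ => thetaPoly a b (limitRatio a b / 8 : ℂ) 0 (thetaVec τ) (thetaVec (3 * τ)))
    (fun τ hτ => hasSum_thetaPoly a b _ (hτ ▸ hy))
    (fun τ hτ => (hM τ (hτ ▸ hy)).trans_eq (by rw [hτ])) m
  rw [tsum_thetaCoeff h8] at this
  have e : ((Nstar a b m : ℂ) - limitRatio a b * N a b m) =
    (((Nstar a b m : ℝ) - limitRatio a b * N a b m : ℝ) : ℂ) := by push_cast; ring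
  rw [e, Complex.norm_real, Real.norm_eq_abs] at this
  refine this.trans_eq ?_
  rw [show Real.pi * m * y / 4 = Real.pi / 4 by simp only [y]; field_simp]
  simp only [y]
  rw [one_div, Real.inv_rpow hm'.le, Real.rpow_neg hm'.le, inv_inv]
  ring

lemma exists_hermitian_eq_one {D : ℤ} (hD : D = 1 ∨ D = 3) (n : ℕ) : ∀ A C e f : ℤ,
    0 < A → 0 < C → A * C = e ^ 2 + f ^ 2 + D → (D = 1 ∨ Odd A ∨ Odd C) → A + C ≤ n →
    ∃ p q r s : ℤ, A * (p ^ 2 + q ^ 2) + 2 * ((e * r - f * s) * p + (e * s + f * r) * q) +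
      C * (r ^ 2 + s ^ 2) = 1 := by
  induction n with
  | zero => intro A C e f hA hC _ _ h; push_cast at h; omega
  | succ n ih =>
    have key : ∀ A C e f : ℤ, 0 < A → A ≤ C → A * C = e ^ 2 + f ^ 2 + D →
        (D = 1 ∨ Odd A ∨ Odd C) → A + C ≤ n + 1 →
        ∃ p q r s : ℤ, A * (p ^ 2 + q ^ 2) + 2 * ((e * r - f * s) * p + (e * s + f * r) * q) +
          C * (r ^ 2 + s ^ 2) = 1 := by
      intro A C e f hA hAC h hodd hn
      have hDpos : 0 < D := by omega
      have step (e' f' C' : ℤ) (h' : A * C' = e' ^ 2 + f' ^ 2 + D) (hC' : C' < C)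
          (hp : Even (C' - C - A)) :
          ∃ p q r s : ℤ, A * (p ^ 2 + q ^ 2) +
            2 * ((e' * r - f' * s) * p + (e' * s + f' * r) * q) + C' * (r ^ 2 + s ^ 2) = 1 := by
        refine ih A C' e' f' hA ?_ h' ?_ (by omega)
        · refine pos_of_mul_pos_right (a := A) ?_ hA.le
          rw [h']; positivity
        · rcases hodd with hodd | hodd
          · exact Or.inl hodd
          · right
            obtain ⟨k, hk⟩ := hp
            rw [show C' = k + k + C + A by omega]
            rcases Int.even_or_odd A with h1 | h1
            · right
              rcases hodd with h2 | h2
              · exact absurd h1 (Int.not_even_iff_odd.mpr h2)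
              · exact ((Even.add_self k).add_odd h2).add_even h1
            · exact Or.inl h1
      by_cases h1 : A < 2 * e
      · obtain ⟨p, q, r, s, H⟩ := step (e - A) f (C - 2 * e + A) (by linear_combination h)
          (by omega) ⟨-e, by ring⟩
        exact ⟨p - r, q - s, r, s, by linear_combination H⟩
      by_cases h2 : 2 * e < -A
      · obtain ⟨p, q, r, s, H⟩ := step (e + A) f (C + 2 * e + A) (by linear_combination h)
          (by omega) ⟨e, by ring⟩
        exact ⟨p + r, q + s, r, s, by linear_combination H⟩
      by_cases h3 : A < 2 * f
      · obtain ⟨p, q, r, s, H⟩ := step e (f - A) (C - 2 * f + A) (by linear_combination h)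
          (by omega) ⟨-f, by ring⟩
        exact ⟨p + s, q - r, r, s, by linear_combination H⟩
      by_cases h4 : 2 * f < -A
      · obtain ⟨p, q, r, s, H⟩ := step e (f + A) (C + 2 * f + A) (by linear_combination h)
          (by omega) ⟨f, by ring⟩
        exact ⟨p - s, q + r, r, s, by linear_combination H⟩
      have he : (2 * e) ^ 2 ≤ A ^ 2 := sq_le_sq' (by omega) (by omega)
      have hf : (2 * f) ^ 2 ≤ A ^ 2 := sq_le_sq' (by omega) (by omega)
      have hA2 : A < 3 := by
        by_contra hA3
        have h5 := mul_le_mul_of_nonneg_left hAC hA.le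
        have h6 : 9 ≤ A * A := by nlinarith
        have h7 : D ≤ 3 := by omega
        nlinarith
      obtain rfl | rfl : A = 1 ∨ A = 2 := by omega
      · exact ⟨1, 0, 0, 0, by ring⟩
      · exfalso
        have e1 : -1 ≤ e := by omega
        have e2 : e ≤ 1 := by omega
        have f1 : -1 ≤ f := by omega
        have f2 : f ≤ 1 := by omega
        rcases hD with rfl | rfl
        · interval_cases e <;> interval_cases f <;> omega
        · have : Odd C := by
            rcases hodd with hodd | hodd | hodd
            · omega
            · exact absurd hodd (by decide)
            · exact hodd
          obtain ⟨k, rfl⟩ := this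
          interval_cases e <;> interval_cases f <;> omega
    intro A C e f hA hC h hodd hn
    push_cast at hn
    rcases le_total A C with hAC | hAC
    · exact key A C e f hA hAC h hodd hn
    · obtain ⟨p, q, r, s, H⟩ := key C A e (-f) hC hAC (by linear_combination h)
        (by tauto) (by omega)
      exact ⟨r, s, p, q, by linear_combination H⟩

/-- A solution of `x² + y² + D (r² + s²) = u` attached to a solution `(e, f)` of
`e² + f² = -D` modulo `u`. -/
lemma exists_rep_of_zmod {D : ℤ} (hD : D = 1 ∨ D = 3) {u : ℕ} (hodd : Odd u)
    {e f : ZMod u} (h : e ^ 2 + f ^ 2 = -D) : ∃ x y r s : ℤ,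
    x ^ 2 + y ^ 2 + D * (r ^ 2 + s ^ 2) = u ∧ (x : ZMod u) = e * r - f * s ∧
    (y : ZMod u) = e * s + f * r ∧ ∃ p q c : ZMod u,
      1 = 2 * (x * p + y * q) + (r ^ 2 + s ^ 2) * c := by
  have : NeZero u := ⟨by rintro rfl; exact absurd hodd (by decide)⟩
  have hu : 0 < (u : ℤ) := by exact_mod_cast hodd.pos
  obtain ⟨e, rfl⟩ := ZMod.intCast_surjective e
  obtain ⟨f, rfl⟩ := ZMod.intCast_surjective f
  obtain ⟨C, hC⟩ : (u : ℤ) ∣ e ^ 2 + f ^ 2 + D := by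
    rw [← ZMod.intCast_zmod_eq_zero_iff_dvd]
    push_cast
    linear_combination h
  have hCpos : 0 < C := by
    refine pos_of_mul_pos_right (a := (u : ℤ)) ?_ hu.le
    rw [← hC]
    have : 0 < D := by omega
    positivity
  obtain ⟨p, q, r, s, H⟩ := exists_hermitian_eq_one hD (u + C).toNat u C e f hu hCpos hC.symm
    (Or.inr (Or.inl (by exact_mod_cast hodd))) (by omega)
  refine ⟨e * r - f * s + u * p, e * s + f * r + u * q, r, s, ?_, by simp, by simp, p, q, C, ?_⟩
  · linear_combination u * H + (r ^ 2 + s ^ 2) * hC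
  · have := congrArg (Int.cast : ℤ → ZMod u) H
    push_cast [ZMod.natCast_self] at this ⊢
    linear_combination -this

lemma card_zmod_le_ncard_rep {D : ℤ} (hD : D = 1 ∨ D = 3) {u : ℕ} (hodd : Odd u) :
    Nat.card {l : ZMod u × ZMod u // l.1 ^ 2 + l.2 ^ 2 = -D} ≤
      {v : ℤ × ℤ × ℤ × ℤ | v.1 ^ 2 + v.2.1 ^ 2 + D * (v.2.2.1 ^ 2 + v.2.2.2 ^ 2) = u}.ncard := by
  choose x y r s hrep hx hy p q c hone using
    fun l : {l : ZMod u × ZMod u // l.1 ^ 2 + l.2 ^ 2 = -D} => exists_rep_of_zmod hD hodd l.2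
  have hDpos : 1 ≤ D := by omega
  have hfin : {v : ℤ × ℤ × ℤ × ℤ |
      v.1 ^ 2 + v.2.1 ^ 2 + D * (v.2.2.1 ^ 2 + v.2.2.2 ^ 2) = u}.Finite := by
    refine (Set.finite_Icc (-(u : ℤ), -(u : ℤ), -(u : ℤ), -(u : ℤ)) (u, u, u, u)).subset ?_
    rintro ⟨a, b, c, d⟩ h
    rw [Set.mem_ofPred_eq] at h
    simp only at h
    have h0 : c ^ 2 + d ^ 2 ≤ D * (c ^ 2 + d ^ 2) :=
      le_mul_of_one_le_left (by positivity) hDpos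
    have key (z : ℤ) (hz : z ^ 2 ≤ u) : -(u : ℤ) ≤ z ∧ z ≤ u := by
      constructor <;> nlinarith [Int.le_self_sq z, Int.le_self_sq (-z)]
    have ha := key a (by nlinarith [sq_nonneg b, sq_nonneg c, sq_nonneg d])
    have hb := key b (by nlinarith [sq_nonneg a, sq_nonneg c, sq_nonneg d])
    have hc := key c (by nlinarith [sq_nonneg b, sq_nonneg a, sq_nonneg d])
    have hd := key d (by nlinarith [sq_nonneg b, sq_nonneg c, sq_nonneg a])
    exact ⟨⟨ha.1, hb.1, hc.1, hd.1⟩, ⟨ha.2, hb.2, hc.2, hd.2⟩⟩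
  rw [← Nat.card_coe_set_eq]
  have := hfin.to_subtype
  refine Nat.card_le_card_of_injective (fun l => ⟨(x l, y l, r l, s l), hrep l⟩) fun l l' hl => ?_
  simp only [Subtype.mk.injEq, Prod.mk.injEq] at hl
  obtain ⟨h1, h2, h3, h4⟩ := hl
  have hx1 := hx l
  have hy1 := hy l
  have hx2 := hx l'
  have hy2 := hy l'
  have h5 := hone l
  have h6 := l.2
  have h7 := l'.2
  rw [← h1, ← h3, ← h4] at hx2
  rw [← h2, ← h3, ← h4] at hy2
  generalize x l = x at *
  generalize y l = y at *
  generalize r l = r at *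
  generalize s l = s at *
  generalize p l = p at *
  generalize q l = q at *
  generalize c l = c at *
  obtain ⟨⟨e, f⟩, hl⟩ := l
  obtain ⟨⟨e', f'⟩, hl'⟩ := l'
  simp only at *
  have a1 : (e - e') * r - (f - f') * s = 0 := by linear_combination hx2 - hx1
  have a2 : (e - e') * s + (f - f') * r = 0 := by linear_combination hy2 - hy1
  have a3 : (e - e') * x + (f - f') * y = 0 := by
    have b1 : e * x + f * y = -D * r := by
      linear_combination e * hx1 + f * hy1 + r * h6
    have b2 : e' * x + f' * y = -D * r := by
      linear_combination e' * hx2 + f' * hy2 + r * h7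
    linear_combination b1 - b2
  have a4 : (e - e') * y - (f - f') * x = 0 := by
    have b1 : e * y - f * x = -D * s := by
      linear_combination e * hy1 - f * hx1 + s * h6
    have b2 : e' * y - f' * x = -D * s := by
      linear_combination e' * hy2 - f' * hx2 + s * h7
    linear_combination b1 - b2
  have a5 : (e - e') * x - (f - f') * y = 0 := by
    linear_combination (e - e') * hx1 - (f - f') * hy1 + e * a1 - f * a2
  have a6 : (e - e') * y + (f - f') * x = 0 := by
    linear_combination (e - e') * hy1 + (f - f') * hx1 + e * a2 + f * a1
  have he : e - e' = 0 := by
    linear_combination (e - e') * h5 + p * (a3 + a5) + q * (a4 + a6) + c * (r * a1 + s * a2)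
  have hf : f - f' = 0 := by
    linear_combination (f - f') * h5 + p * (a6 - a4) + q * (a3 - a5) + c * (r * a2 - s * a1)
  simp only [Subtype.mk.injEq, Prod.mk.injEq]
  exact ⟨sub_eq_zero.mp he, sub_eq_zero.mp hf⟩

lemma exists_sq_add_sq_zmod {D : ℤ} {u : ℕ} (hodd : Odd u) (hcop : IsCoprime (u : ℤ) D) :
    ∃ e f : ZMod u, e ^ 2 + f ^ 2 = -D := by
  have : NeZero u := ⟨by rintro rfl; exact absurd hodd (by decide)⟩
  have hc4 : Nat.Coprime 4 u := by
    rw [show 4 = 2 ^ 2 by norm_num]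
    exact (Nat.coprime_two_left.mpr hodd).pow_left 2
  have hunit : IsUnit ((ZMod.chineseRemainder hc4).symm (1, -(D : ZMod u))) := by
    rw [MulEquiv.isUnit_map, Prod.isUnit_iff]
    refine ⟨isUnit_one, IsUnit.neg ?_⟩
    rw [ZMod.coe_int_isUnit_iff_isCoprime]
    exact hcop
  have : NeZero (4 * u) := ⟨by have := NeZero.ne u; omega⟩
  obtain ⟨p, -, hp, hpe⟩ := Nat.forall_exists_prime_gt_and_eq_mod hunit 0
  have h1 := congrArg (ZMod.chineseRemainder hc4) hpe
  rw [RingEquiv.apply_symm_apply, map_natCast, Prod.ext_iff] at h1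
  have h4 : p % 4 ≠ 3 := by
    have := h1.1
    simp only [Prod.fst_natCast] at this
    rw [show (1 : ZMod 4) = ((1 : ℕ) : ZMod 4) by simp, ZMod.natCast_eq_natCast_iff'] at this
    omega
  have := Fact.mk hp
  obtain ⟨a, b, hab⟩ := Nat.Prime.sq_add_sq h4
  refine ⟨a, b, ?_⟩
  have h5 := h1.2
  simp only [Prod.snd_natCast] at h5
  rw [← h5, ← hab]
  push_cast
  rfl

lemma card_isUnit_le_card_zmod {D : ℤ} {u : ℕ} (hodd : Odd u) (hcop : IsCoprime (u : ℤ) D) :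
    Nat.card {s : ZMod u // IsUnit (s ^ 2 + 1)} ≤
      Nat.card {l : ZMod u × ZMod u // l.1 ^ 2 + l.2 ^ 2 = -D} := by
  have : NeZero u := ⟨by rintro rfl; exact absurd hodd (by decide)⟩
  obtain ⟨e, f, hef⟩ := exists_sq_add_sq_zmod hodd hcop
  have hD : IsUnit (-(D : ZMod u)) := by
    refine IsUnit.neg ?_
    rw [ZMod.coe_int_isUnit_iff_isCoprime]
    exact hcop
  have h2 : IsUnit (2 : ZMod u) := by
    have := (ZMod.isUnit_iff_coprime 2 u).mpr (Nat.coprime_two_left.mpr hodd)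
    exact_mod_cast this
  have hw (s : {s : ZMod u // IsUnit (s ^ 2 + 1)}) : ∃ w, (s.1 ^ 2 + 1) * w = 1 :=
    s.2.exists_right_inv
  choose w hw using hw
  refine Nat.card_le_card_of_injective
    (fun s => ⟨(e * (1 - 2 * w s) - f * (2 * s.1 * w s), e * (2 * s.1 * w s) + f * (1 - 2 * w s)),
      ?_⟩) ?_
  · have := hw s
    linear_combination hef + 4 * (e ^ 2 + f ^ 2) * w s * this
  · intro s t hst
    simp only [Subtype.mk.injEq, Prod.mk.injEq] at hst
    obtain ⟨g1, g2⟩ := hst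
    have hs := hw s
    have ht := hw t
    have k1 : -(D : ZMod u) * 2 * (w s - w t) = 0 := by
      linear_combination -(e * g1 + f * g2) - 2 * (w s - w t) * hef
    have k2 : -(D : ZMod u) * 2 * (s.1 * w s - t.1 * w t) = 0 := by
      linear_combination (e * g2 - f * g1) - 2 * (s.1 * w s - t.1 * w t) * hef
    rw [(hD.mul h2).mul_right_eq_zero] at k1 k2
    apply Subtype.ext
    linear_combination (t.1 - s.1) * hs + (s.1 ^ 2 + 1) * (k2 - t.1 * k1)

lemma card_isUnit_mul {m n : ℕ} (h : Nat.Coprime m n) :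
    Nat.card {s : ZMod (m * n) // IsUnit (s ^ 2 + 1)} =
      Nat.card {s : ZMod m // IsUnit (s ^ 2 + 1)} *
        Nat.card {s : ZMod n // IsUnit (s ^ 2 + 1)} := by
  rw [← Nat.card_prod]
  have e1 : {s : ZMod (m * n) // IsUnit (s ^ 2 + 1)} ≃
      {s : ZMod m × ZMod n // IsUnit (s.1 ^ 2 + 1) ∧ IsUnit (s.2 ^ 2 + 1)} := by
    refine (ZMod.chineseRemainder h).toEquiv.subtypeEquiv fun s => ?_
    rw [← MulEquiv.isUnit_map (ZMod.chineseRemainder h), Prod.isUnit_iff]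
    simp
  exact Nat.card_congr (e1.trans (Equiv.subtypeProdEquivProd
    (p := fun s : ZMod m => IsUnit (s ^ 2 + 1)) (q := fun s : ZMod n => IsUnit (s ^ 2 + 1))))

lemma card_dvd_sq_add_one_le {p : ℕ} (hp : p.Prime) (k : ℕ) :
    ((Finset.range (p * k)).filter fun s => p ∣ s ^ 2 + 1).card ≤
      (if p = 3 then 0 else 2) * k := by
  have : NeZero p := ⟨hp.ne_zero⟩
  have := Fact.mk hp
  have hper : Function.Periodic (fun s => p ∣ s ^ 2 + 1) p := by
    intro s
    simp only [eq_iff_iff]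
    rw [← ZMod.natCast_eq_zero_iff, ← ZMod.natCast_eq_zero_iff]
    simp
  have hone : p.count (fun s => p ∣ s ^ 2 + 1) ≤ if p = 3 then 0 else 2 := by
    split_ifs with h3
    · subst h3; decide
    rw [Nat.count_eq_card_filter_range]
    have hinj : Set.InjOn (fun s : ℕ => (s : ZMod p))
        ((Finset.range p).filter fun s => p ∣ s ^ 2 + 1) := by
      intro s hs t ht hst
      simp only [Finset.coe_filter, Finset.mem_range, Set.mem_ofPred_eq] at hs ht
      simp only at hst
      rw [ZMod.natCast_eq_natCast_iff', Nat.mod_eq_of_lt hs.1, Nat.mod_eq_of_lt ht.1] at hst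
      exact hst
    rw [← Finset.card_image_of_injOn hinj]
    refine le_trans (Finset.card_le_card (t := (Polynomial.nthRoots 2 (-1 : ZMod p)).toFinset) ?_)
      ((Multiset.toFinset_card_le _).trans (Polynomial.card_nthRoots 2 _))
    intro s hs
    simp only [Finset.mem_image, Finset.mem_filter] at hs
    obtain ⟨t, ⟨-, ht⟩, rfl⟩ := hs
    rw [Multiset.mem_toFinset, Polynomial.mem_nthRoots (by norm_num)]
    rw [← ZMod.natCast_eq_zero_iff] at ht
    push_cast at ht
    linear_combination ht
  induction k with
  | zero => simp
  | succ k ih =>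
    rw [← Nat.count_eq_card_filter_range] at ih ⊢
    rw [mul_add, mul_one, Nat.count_add]
    have hs : ∀ k, (fun s => p ∣ (p * k + s) ^ 2 + 1) = fun s => p ∣ s ^ 2 + 1 := by
      intro k
      funext s
      have := hper.nat_mul k s
      simp only [Nat.cast_id] at this
      rw [← this, add_comm s, mul_comm k]
    simp only [hs]
    linarith

lemma pow_le_card_isUnit_prime_pow {p : ℕ} (hp : p.Prime) (hodd : Odd p) {k : ℕ} (hk : 0 < k) :
    (p ^ k) ^ 2 ≤ Nat.card {s : ZMod (p ^ k) // IsUnit (s ^ 2 + 1)} ^ 3 := by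
  obtain ⟨k, rfl⟩ : ∃ j, k = j + 1 := ⟨k - 1, by omega⟩
  have : NeZero (p ^ (k + 1)) := ⟨pow_ne_zero _ hp.ne_zero⟩
  have hcard : p ^ (k + 1) ≤ Nat.card {s : ZMod (p ^ (k + 1)) // IsUnit (s ^ 2 + 1)} +
      ((Finset.range (p ^ (k + 1))).filter fun s => p ∣ s ^ 2 + 1).card := by
    have h1 : ((Finset.range (p ^ (k + 1))).filter fun s => ¬ p ∣ s ^ 2 + 1).card ≤
        Nat.card {s : ZMod (p ^ (k + 1)) // IsUnit (s ^ 2 + 1)} := by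
      rw [← Fintype.card_coe, ← Nat.card_eq_fintype_card]
      refine Nat.card_le_card_of_injective (fun s => ⟨((s.1 : ℕ) : ZMod (p ^ (k + 1))), ?_⟩) ?_
      · have hs := (Finset.mem_filter.mp s.2).2
        have := (ZMod.isUnit_iff_coprime (s.1 ^ 2 + 1) (p ^ (k + 1))).mpr
          (((Nat.Prime.coprime_iff_not_dvd hp).mpr hs).symm.pow_right _)
        push_cast at this
        exact this
      · rintro ⟨s, hs⟩ ⟨t, ht⟩ hst
        simp only [Subtype.mk.injEq] at hst ⊢
        rw [Finset.mem_filter, Finset.mem_range] at hs ht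
        rwa [ZMod.natCast_eq_natCast_iff', Nat.mod_eq_of_lt hs.1, Nat.mod_eq_of_lt ht.1] at hst
    have h2 := Finset.card_filter_add_card_filter_not (s := Finset.range (p ^ (k + 1)))
      (fun s => p ∣ s ^ 2 + 1)
    rw [Finset.card_range] at h2
    omega
  have hle := card_dvd_sq_add_one_le hp (p ^ k)
  rw [← pow_succ'] at hle
  generalize Nat.card {s : ZMod (p ^ (k + 1)) // IsUnit (s ^ 2 + 1)} = c at *
  have hpos : 1 ≤ p ^ k := Nat.one_le_pow _ _ hp.pos
  split_ifs at hle with h3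
  · have : p ^ (k + 1) ≤ c := by omega
    calc (p ^ (k + 1)) ^ 2 ≤ (p ^ (k + 1)) ^ 3 :=
          Nat.pow_le_pow_right (Nat.pos_of_neZero _) (by norm_num)
      _ ≤ c ^ 3 := Nat.pow_le_pow_left this 3
  · have h5 : 5 ≤ p := by
      have := hp.two_le
      obtain ⟨j, rfl⟩ := hodd
      omega
    obtain ⟨q, rfl⟩ : ∃ q, p = q + 5 := ⟨p - 5, by omega⟩
    have h6 : (q + 3) * (q + 5) ^ k ≤ c := by
      rw [pow_succ] at hcard hle
      nlinarith
    have h7 : (q + 5) ^ 2 ≤ (q + 3) ^ 3 := by ring_nf; nlinarith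
    calc ((q + 5) ^ (k + 1)) ^ 2 = (q + 5) ^ 2 * ((q + 5) ^ k) ^ 2 := by ring
      _ ≤ (q + 3) ^ 3 * ((q + 5) ^ k) ^ 3 :=
          Nat.mul_le_mul h7 (Nat.pow_le_pow_right hpos (by norm_num))
      _ = ((q + 3) * (q + 5) ^ k) ^ 3 := by ring
      _ ≤ c ^ 3 := Nat.pow_le_pow_left h6 3

lemma sq_le_card_isUnit_pow_three (u : ℕ) (hodd : Odd u) :
    u ^ 2 ≤ Nat.card {s : ZMod u // IsUnit (s ^ 2 + 1)} ^ 3 := by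
  induction u using Nat.recOnPosPrimePosCoprime with
  | zero => simp
  | one =>
    simp
  | prime_pow p k hp hk =>
    exact pow_le_card_isUnit_prime_pow hp (Nat.Odd.of_mul_left (n := p ^ (k-1)) (by
      rwa [← pow_succ', Nat.sub_add_cancel hk])) hk
  | coprime a b ha hb hab iha ihb =>
    rw [card_isUnit_mul hab, mul_pow, mul_pow]
    exact Nat.mul_le_mul (iha (Nat.Odd.of_mul_left hodd)) (ihb (Nat.Odd.of_mul_right hodd))

/-- The number of solutions of `x² + y² + D (r² + s²) = u` is at least `u ^ (2 / 3)`. -/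
lemma sq_le_ncard_rep_pow_three {D : ℤ} (hD : D = 1 ∨ D = 3) {u : ℕ} (hodd : Odd u)
    (hcop : IsCoprime (u : ℤ) D) : u ^ 2 ≤ {v : ℤ × ℤ × ℤ × ℤ |
      v.1 ^ 2 + v.2.1 ^ 2 + D * (v.2.2.1 ^ 2 + v.2.2.2 ^ 2) = u}.ncard ^ 3 :=
  (sq_le_card_isUnit_pow_three u hodd).trans (Nat.pow_le_pow_left
    ((card_isUnit_le_card_zmod hodd hcop).trans (card_zmod_le_ncard_rep hD hodd)) 3)

lemma sum_Nstar_le_succ_left (a b : ℕ) (m : ℤ) (S : Finset ℤ) (hS : ∀ x ∈ S, Odd x) :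
    ∑ x ∈ S, Nstar a b (m - 1 * x ^ 2) ≤ Nstar (a + 1) b m := by
  simp only [Nstar_eq_ncard, ← Nat.card_coe_set_eq]
  rw [← Finset.sum_coe_sort]
  have hfin (m : ℤ) (a b : ℕ) : Finite {p : (Fin a → ℤ) × (Fin b → ℤ) |
      ((∀ i, Odd (p.1 i)) ∧ ∀ j, Odd (p.2 j)) ∧ quadForm a b p = m} :=
    ((finite_quadForm_eq a b m).subset fun p hp => hp.2).to_subtype
  have := hfin m (a + 1) b
  have := fun x : S => hfin (m - 1 * x.1 ^ 2) a b
  rw [← Nat.card_sigma]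
  refine Nat.card_le_card_of_injective
    (fun p => ⟨(Fin.cons p.1.1 p.2.1.1, p.2.1.2), ⟨?_, p.2.2.1.2⟩, ?_⟩) ?_
  · exact Fin.cases (hS _ p.1.2) p.2.2.1.1
  · have h := p.2.2.2
    simp only [quadForm, Fin.sum_univ_succ, Fin.cons_zero, Fin.cons_succ] at h ⊢
    linear_combination h
  · rintro ⟨⟨x, hx⟩, ⟨⟨p, q⟩, hp⟩⟩ ⟨⟨y, hy⟩, ⟨⟨p', q'⟩, hp'⟩⟩ h
    simp only [Subtype.mk.injEq, Prod.mk.injEq, Fin.cons_inj] at h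
    obtain ⟨⟨rfl, rfl⟩, rfl⟩ := h
    rfl

lemma sum_Nstar_le_succ_right (a b : ℕ) (m : ℤ) (S : Finset ℤ) (hS : ∀ x ∈ S, Odd x) :
    ∑ x ∈ S, Nstar a b (m - 3 * x ^ 2) ≤ Nstar a (b + 1) m := by
  simp only [Nstar_eq_ncard, ← Nat.card_coe_set_eq]
  rw [← Finset.sum_coe_sort]
  have hfin (m : ℤ) (a b : ℕ) : Finite {p : (Fin a → ℤ) × (Fin b → ℤ) |
      ((∀ i, Odd (p.1 i)) ∧ ∀ j, Odd (p.2 j)) ∧ quadForm a b p = m} :=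
    ((finite_quadForm_eq a b m).subset fun p hp => hp.2).to_subtype
  have := hfin m a (b + 1)
  have := fun x : S => hfin (m - 3 * x.1 ^ 2) a b
  rw [← Nat.card_sigma]
  refine Nat.card_le_card_of_injective
    (fun p => ⟨(p.2.1.1, Fin.cons p.1.1 p.2.1.2), ⟨p.2.2.1.1, ?_⟩, ?_⟩) ?_
  · exact Fin.cases (hS _ p.1.2) p.2.2.1.2
  · have h := p.2.2.2
    simp only [quadForm, Fin.sum_univ_succ, Fin.cons_zero, Fin.cons_succ] at h ⊢
    linear_combination h
  · rintro ⟨⟨x, hx⟩, ⟨⟨p, q⟩, hp⟩⟩ ⟨⟨y, hy⟩, ⟨⟨p', q'⟩, hp'⟩⟩ h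
    simp only [Subtype.mk.injEq, Prod.mk.injEq, Fin.cons_inj] at h
    obtain ⟨rfl, rfl, rfl⟩ := h
    rfl

/-- On the integers satisfying `C`, the function `f` grows at least like `m ^ e`. -/
def GrowsOn (f : ℤ → ℕ) (C : ℤ → Prop) (e : ℝ) : Prop :=
  ∃ c : ℝ, 0 < c ∧ ∃ M : ℤ, ∀ m : ℤ, M ≤ m → C m → c * (m : ℝ) ^ e ≤ f m

lemma GrowsOn.sum_odd {f g : ℤ → ℕ} {C C' : ℤ → Prop} {e : ℝ} (hf : GrowsOn f C e) (he : 0 ≤ e)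
    {w : ℤ} (hw : 0 ≤ w) (hw3 : w ≤ 3)
    (hfg : ∀ m, ∀ S : Finset ℤ, (∀ x ∈ S, Odd x) → ∑ x ∈ S, f (m - w * x ^ 2) ≤ g m)
    (hC : ∀ m, C' m → ∃ r, 0 ≤ r ∧ r < 48 ∧ Odd r ∧ ∀ t : ℤ, C (m - w * (r ^ 2 + 48 * t))) :
    GrowsOn g C' (e + 1 / 2) := by
  obtain ⟨c, hc, M, hM⟩ := hf
  refine ⟨c * (1 / 2) ^ e / 240, by positivity, max (2 * M) (240 ^ 2), fun m hm hCm => ?_⟩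
  obtain ⟨r, hr, hr48, hrodd, hr'⟩ := hC m hCm
  have hm2 := le_trans (le_max_left _ _) hm
  have hm3 := le_trans (le_max_right _ _) hm
  have hmR : (240 : ℝ) ^ 2 ≤ m := by exact_mod_cast hm3
  have hmpos : (0 : ℝ) < m := by linarith
  set y : ℝ := Real.sqrt m / 120 with hy
  have hsq : Real.sqrt m ^ 2 = m := Real.sq_sqrt hmpos.le
  have hs240 : 240 ≤ Real.sqrt m := Real.le_sqrt_of_sq_le hmR
  have hJ : y / 2 ≤ (⌊y⌋₊ : ℝ) := by
    have := (Nat.lt_floor_add_one y).le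
    have : 2 ≤ y := by rw [hy]; linarith
    linarith
  let S : Finset ℤ := (Finset.range ⌊y⌋₊).image fun j : ℕ => r + 48 * (j : ℤ)
  have hcard : S.card = ⌊y⌋₊ := by
    rw [Finset.card_image_of_injective, Finset.card_range]
    intro i j hij
    simp only at hij
    omega
  have hmem : ∀ x ∈ S, Odd x ∧ C (m - w * x ^ 2) ∧ (m : ℝ) / 2 ≤ ((m - w * x ^ 2 : ℤ) : ℝ) := by
    intro x hx
    obtain ⟨j, hj, rfl⟩ := Finset.mem_image.mp hx
    rw [Finset.mem_range] at hj
    refine ⟨?_, ?_, ?_⟩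
    · exact hrodd.add_even ⟨24 * j, by ring⟩
    · convert hr' (2 * r * j + 48 * j ^ 2) using 2
      ring
    · have h1 : ((j : ℝ) + 1) ≤ y := by
        have : ((j + 1 : ℕ) : ℝ) ≤ (⌊y⌋₊ : ℝ) := by exact_mod_cast hj
        have h2 := Nat.floor_le (show 0 ≤ y by positivity)
        push_cast at this
        linarith
      have h2 : (0 : ℝ) ≤ ((r + 48 * j : ℤ) : ℝ) := by exact_mod_cast (by positivity)
      have h3 : ((r + 48 * j : ℤ) : ℝ) ≤ 48 * y := by
        have : ((r : ℤ) : ℝ) ≤ 48 := by exact_mod_cast hr48.le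
        push_cast
        linarith
      have h4 : ((r + 48 * j : ℤ) : ℝ) ^ 2 ≤ (48 * y) ^ 2 := pow_le_pow_left₀ h2 h3 2
      have h5 : (48 * y) ^ 2 = m * (4 / 25) := by
        rw [hy]
        linear_combination (4 / 25) * hsq
      have h6 : (w : ℝ) ≤ 3 := by exact_mod_cast hw3
      have h7 : (0 : ℝ) ≤ w := by exact_mod_cast hw
      rw [Int.cast_sub, Int.cast_mul, Int.cast_pow]
      nlinarith [mul_le_mul h6 h4 (sq_nonneg _) (by norm_num)]
  have hsum := hfg m S fun x hx => (hmem x hx).1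
  have hterm : ∀ x ∈ S, c * ((m : ℝ) / 2) ^ e ≤ (f (m - w * x ^ 2) : ℝ) := by
    intro x hx
    obtain ⟨-, h1, h2⟩ := hmem x hx
    have h3 : M ≤ m - w * x ^ 2 := by
      have : (2 * M : ℝ) ≤ m := by exact_mod_cast hm2
      have : (M : ℝ) ≤ ((m - w * x ^ 2 : ℤ) : ℝ) := by linarith
      exact_mod_cast this
    refine le_trans ?_ (hM _ h3 h1)
    exact mul_le_mul_of_nonneg_left (Real.rpow_le_rpow (by positivity) h2 he) hc.le
  calc c * (1 / 2) ^ e / 240 * (m : ℝ) ^ (e + 1 / 2)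
      = (y / 2) * (c * ((m : ℝ) / 2) ^ e) := by
        rw [Real.rpow_add hmpos, ← Real.sqrt_eq_rpow, hy, div_eq_mul_one_div (m : ℝ) 2,
          Real.mul_rpow hmpos.le (by norm_num)]
        ring
    _ ≤ S.card * (c * ((m : ℝ) / 2) ^ e) := by
        rw [hcard]
        exact mul_le_mul_of_nonneg_right hJ (by positivity)
    _ ≤ ∑ x ∈ S, (f (m - w * x ^ 2) : ℝ) := by
        rw [← nsmul_eq_mul]
        exact Finset.card_nsmul_le_sum _ _ _ hterm
    _ ≤ g m := by exact_mod_cast hsum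

lemma ncard_rep_le_Nstar_four_zero {u : ℕ} (hodd : Odd u) :
    {v : ℤ × ℤ × ℤ × ℤ | v.1 ^ 2 + v.2.1 ^ 2 + 1 * (v.2.2.1 ^ 2 + v.2.2.2 ^ 2) = u}.ncard ≤
      Nstar 4 0 (4 * u) := by
  rw [Nstar_eq_ncard]
  refine Set.ncard_le_ncard_of_injOn
    (fun v => (![v.1 - v.2.1 - v.2.2.1 - v.2.2.2, v.1 + v.2.1 + v.2.2.1 - v.2.2.2,
      v.1 - v.2.1 + v.2.2.1 + v.2.2.2, v.1 + v.2.1 - v.2.2.1 + v.2.2.2], ![])) ?_ ?_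
    ((finite_quadForm_eq 4 0 (4 * u)).subset fun p hp => hp.2)
  · rintro ⟨x, y, r, s⟩ hv
    rw [Set.mem_ofPred_eq] at hv
    simp only at hv
    have hpar : Odd (x + y + r + s) := by
      have : Odd (u : ℤ) := by exact_mod_cast hodd
      rw [← hv] at this
      simpa [Int.odd_add, Int.odd_pow, parity_simps, add_assoc] using this
    refine ⟨⟨?_, fun j => j.elim0⟩, ?_⟩
    · intro i
      fin_cases i <;> simp <;> grind
    · simp [quadForm, Fin.sum_univ_four]
      linear_combination 4 * hv
  · rintro ⟨x, y, r, s⟩ - ⟨x', y', r', s'⟩ - h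
    simp at h
    simp only [Prod.mk.injEq]
    omega

lemma Nstar_four_zero_le_Nstar_zero_four (m : ℤ) : Nstar 4 0 m ≤ Nstar 0 4 (3 * m) := by
  rw [Nstar_eq_ncard, Nstar_eq_ncard]
  refine Set.ncard_le_ncard_of_injOn Prod.swap ?_ Prod.swap_injective.injOn
    ((finite_quadForm_eq 0 4 (3 * m)).subset fun p hp => hp.2)
  rintro ⟨p, q⟩ ⟨⟨h1, h2⟩, h3⟩
  refine ⟨⟨h2, h1⟩, ?_⟩
  simp only [quadForm, Finset.univ_eq_empty, Finset.sum_empty] at h3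
  simp only [quadForm, Finset.univ_eq_empty, Finset.sum_empty, Prod.swap]
  linear_combination 3 * h3

lemma ncard_rep_le_Nstar_two_two {u : ℕ} (hodd : Odd u) :
    {v : ℤ × ℤ × ℤ × ℤ | v.1 ^ 2 + v.2.1 ^ 2 + 3 * (v.2.2.1 ^ 2 + v.2.2.2 ^ 2) = u}.ncard ≤
      Nstar 2 2 (8 * u) := by
  rw [Nstar_eq_ncard]
  refine Set.ncard_le_ncard_of_injOn
    (fun v => (![(v.1 - 3 * v.2.2.1) - (v.2.1 - 3 * v.2.2.2),
        (v.1 - 3 * v.2.2.1) + (v.2.1 - 3 * v.2.2.2)],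
      ![(v.1 + v.2.2.1) - (v.2.1 + v.2.2.2), (v.1 + v.2.2.1) + (v.2.1 + v.2.2.2)])) ?_ ?_
    ((finite_quadForm_eq 2 2 (8 * u)).subset fun p hp => hp.2)
  · rintro ⟨x, y, r, s⟩ hv
    rw [Set.mem_ofPred_eq] at hv
    simp only at hv
    have hpar : Odd (x + y + r + s) := by
      have : Odd (u : ℤ) := by exact_mod_cast hodd
      have h3 : Odd (3 : ℤ) := by decide
      rw [← hv] at this
      simp only [Int.odd_add, Int.even_mul, Int.odd_pow, parity_simps] at this ⊢
      grind
    refine ⟨⟨?_, ?_⟩, ?_⟩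
    · intro i
      fin_cases i <;> simp <;> grind
    · intro i
      fin_cases i <;> simp <;> grind
    · simp [quadForm]
      linear_combination 8 * hv
  · rintro ⟨x, y, r, s⟩ - ⟨x', y', r', s'⟩ - h
    simp at h
    simp only [Prod.mk.injEq]
    omega

lemma rpow_le_of_sq_le_pow_three {u n : ℕ} (h : u ^ 2 ≤ n ^ 3) :
    (u : ℝ) ^ (2 / 3 : ℝ) ≤ n := by
  have h1 : ((u : ℝ) ^ 2) ^ (1 / 3 : ℝ) ≤ ((n : ℝ) ^ 3) ^ (1 / 3 : ℝ) :=
    Real.rpow_le_rpow (by positivity) (by exact_mod_cast h) (by norm_num)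
  rw [← Real.rpow_natCast, ← Real.rpow_natCast, ← Real.rpow_mul (by positivity),
    ← Real.rpow_mul (by positivity)] at h1
  norm_num at h1
  norm_num
  exact h1

lemma growsOn_of_sq_le {f : ℤ → ℕ} {C : ℤ → Prop} (k : ℕ) (hk : 0 < k)
    (h : ∀ m, 0 < m → C m → ∃ u : ℕ, m = k * u ∧ u ^ 2 ≤ f m ^ 3) :
    GrowsOn f C (2 / 3) := by
  refine ⟨(1 / k) ^ (2 / 3 : ℝ), by positivity, 1, fun m hm hC => ?_⟩
  obtain ⟨u, hu, h1⟩ := h m (by omega) hC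
  have hk' : (k : ℝ) ≠ 0 := by positivity
  have hmR : (m : ℝ) = k * u := by rw [hu]; push_cast; rfl
  rw [← Real.mul_rpow (by positivity) (by rw [hmR]; positivity), hmR, ← mul_assoc,
    one_div_mul_cancel hk', one_mul]
  exact rpow_le_of_sq_le_pow_three h1

lemma exists_odd_eq_mul {m k : ℤ} (hk : 0 < k) (hm : 0 < m) (h : 2 * k ∣ m - k) :
    ∃ u : ℕ, Odd u ∧ m = k * u := by
  obtain ⟨t, ht⟩ := h
  have h1 : m = k * (2 * t + 1) := by linear_combination ht
  have h2 : 0 < 2 * t + 1 := pos_of_mul_pos_right (h1 ▸ hm) hk.le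
  lift t to ℕ using by omega
  exact ⟨2 * t + 1, ⟨t, rfl⟩, by rw [h1]; push_cast; rfl⟩

lemma growsOn_Nstar_four_zero : GrowsOn (Nstar 4 0) (fun m => 8 ∣ m - 4) (2 / 3) := by
  refine growsOn_of_sq_le 4 (by norm_num) fun m hm hC => ?_
  obtain ⟨u, hu, rfl⟩ := exists_odd_eq_mul (k := 4) (by norm_num) hm hC
  exact ⟨u, by simp, (sq_le_ncard_rep_pow_three (Or.inl rfl) hu isCoprime_one_right).trans
    (Nat.pow_le_pow_left (ncard_rep_le_Nstar_four_zero hu) 3)⟩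

lemma growsOn_Nstar_zero_four :
    GrowsOn (Nstar 0 4) (fun m => 8 ∣ m - 4 ∧ 3 ∣ m) (2 / 3) := by
  refine growsOn_of_sq_le 12 (by norm_num) fun m hm hC => ?_
  obtain ⟨u, hu, rfl⟩ := exists_odd_eq_mul (k := 12) (by norm_num) hm (by omega)
  refine ⟨u, by simp, (sq_le_ncard_rep_pow_three (Or.inl rfl) hu isCoprime_one_right).trans
    (Nat.pow_le_pow_left ((ncard_rep_le_Nstar_four_zero hu).trans ?_) 3)⟩
  rw [show (12 * u : ℤ) = 3 * (4 * u) by ring]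
  exact Nstar_four_zero_le_Nstar_zero_four _

lemma growsOn_Nstar_two_two :
    GrowsOn (Nstar 2 2) (fun m => 16 ∣ m - 8 ∧ ¬ 3 ∣ m) (2 / 3) := by
  refine growsOn_of_sq_le 8 (by norm_num) fun m hm hC => ?_
  obtain ⟨u, hu, rfl⟩ := exists_odd_eq_mul (k := 8) (by norm_num) hm (by omega)
  have hcop : IsCoprime (u : ℤ) 3 := by
    have : ¬ 3 ∣ u := by omega
    exact_mod_cast Nat.isCoprime_iff_coprime.mpr
      ((Nat.Prime.coprime_iff_not_dvd Nat.prime_three).mpr this).symm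
  exact ⟨u, by simp, (sq_le_ncard_rep_pow_three (Or.inr rfl) hu hcop).trans
    (Nat.pow_le_pow_left (ncard_rep_le_Nstar_two_two hu) 3)⟩

lemma GrowsOn.succ_left {a b : ℕ} {C C' : ℤ → Prop} {e : ℝ} (hf : GrowsOn (Nstar a b) C e)
    (he : 0 ≤ e)
    (hC : ∀ m, C' m → ∃ r, 0 ≤ r ∧ r < 48 ∧ Odd r ∧ ∀ t : ℤ, C (m - 1 * (r ^ 2 + 48 * t))) :
    GrowsOn (Nstar (a + 1) b) C' (e + 1 / 2) :=
  hf.sum_odd he (by norm_num) (by norm_num) (sum_Nstar_le_succ_left a b) hC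

lemma GrowsOn.succ_right {a b : ℕ} {C C' : ℤ → Prop} {e : ℝ} (hf : GrowsOn (Nstar a b) C e)
    (he : 0 ≤ e)
    (hC : ∀ m, C' m → ∃ r, 0 ≤ r ∧ r < 48 ∧ Odd r ∧ ∀ t : ℤ, C (m - 3 * (r ^ 2 + 48 * t))) :
    GrowsOn (Nstar a (b + 1)) C' (e + 1 / 2) :=
  hf.sum_odd he (by norm_num) (by norm_num) (sum_Nstar_le_succ_right a b) hC

lemma growsOn_Nstar_of_le {a₀ b₀ : ℕ} {e : ℝ} (he : 0 ≤ e)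
    (h : GrowsOn (Nstar a₀ b₀) (fun m => 8 ∣ m - (a₀ + 3 * b₀ : ℕ)) e) {a b : ℕ} (ha : a₀ ≤ a)
    (hb : b₀ ≤ b) :
    GrowsOn (Nstar a b) (fun m => 8 ∣ m - (a + 3 * b : ℕ))
      (e + ((a + b : ℕ) - (a₀ + b₀ : ℕ) : ℝ) / 2) := by
  induction a, ha using Nat.le_induction with
  | base =>
    induction b, hb using Nat.le_induction with
    | base => simpa using h
    | succ b hb ih =>
      have hb' : (b₀ : ℝ) ≤ b := by exact_mod_cast hb
      convert ih.succ_right (by push_cast; linarith) (fun m hm => ⟨1, by norm_num, by norm_num, by decide,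
        fun t => ?_⟩) using 1
      · push_cast; ring
      · omega
  | succ a ha ih =>
    have hb' : (b₀ : ℝ) ≤ b := by exact_mod_cast hb
    have ha' : (a₀ : ℝ) ≤ a := by exact_mod_cast ha
    convert ih.succ_left (by push_cast; linarith) (fun m hm => ⟨1, by norm_num, by norm_num, by decide,
      fun t => ?_⟩) using 1
    · push_cast; ring
    · omega

lemma growsOn_Nstar_two_four :
    GrowsOn (Nstar 2 4) (fun m => 8 ∣ m - (2 + 3 * 4 : ℕ)) (5 / 3) := by
  have h1 : GrowsOn (Nstar 1 4) (fun m => 8 ∣ m - 5 ∧ ¬ m % 3 = 2) (2 / 3 + 1 / 2) := by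
    refine growsOn_Nstar_zero_four.succ_left (by norm_num) fun m hm => ?_
    by_cases h : m % 3 = 0
    · exact ⟨3, by norm_num, by norm_num, by decide, fun t => by omega⟩
    · exact ⟨1, by norm_num, by norm_num, by decide, fun t => by omega⟩
  convert h1.succ_left (C' := fun m => 8 ∣ m - (2 + 3 * 4 : ℕ)) (by norm_num) fun m hm => ?_ using 1
  · norm_num
  · by_cases h : m % 3 = 2
    · exact ⟨1, by norm_num, by norm_num, by decide, fun t => by omega⟩
    · exact ⟨3, by norm_num, by norm_num, by decide, fun t => by omega⟩

lemma growsOn_Nstar_three_two :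
    GrowsOn (Nstar 3 2) (fun m => 8 ∣ m - (3 + 3 * 2 : ℕ)) (2 / 3 + 1 / 2) := by
  refine growsOn_Nstar_two_two.succ_left (by norm_num) fun m hm => ?_
  by_cases h : m % 3 = 0 <;> by_cases h16 : m % 16 = 9
  · exact ⟨1, by norm_num, by norm_num, by decide, fun t => by omega⟩
  · exact ⟨5, by norm_num, by norm_num, by decide, fun t => by omega⟩
  · exact ⟨9, by norm_num, by norm_num, by decide, fun t => by omega⟩
  · exact ⟨3, by norm_num, by norm_num, by decide, fun t => by omega⟩

lemma growsOn_Nstar {a b : ℕ} (ha : 1 < a) (hpar : Even (a + b)) (hge : 6 ≤ a + b) :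
    GrowsOn (Nstar a b) (fun m => 8 ∣ m - (a + 3 * b : ℕ)) (((a + b : ℕ) : ℝ) / 2 - 4 / 3) := by
  by_cases h4 : 4 ≤ a
  · convert growsOn_Nstar_of_le (a₀ := 4) (b₀ := 0) (by norm_num) growsOn_Nstar_four_zero h4
      (Nat.zero_le b) using 1
    push_cast; ring
  by_cases hb4 : 4 ≤ b
  · convert growsOn_Nstar_of_le (a₀ := 2) (b₀ := 4) (by norm_num) growsOn_Nstar_two_four
      (show 2 ≤ a by omega) hb4 using 1
    push_cast; ring
  · obtain ⟨k, hk⟩ := hpar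
    convert growsOn_Nstar_of_le (a₀ := 3) (b₀ := 2) (by norm_num) growsOn_Nstar_three_two
      (show 3 ≤ a by omega) (show 2 ≤ b by omega) using 1
    push_cast; ring

/-- A positive definite integral ternary quadratic form of determinant one only takes values that
are sums of three squares. -/
lemma ternary_eq_sum_three_squares (n : ℕ) : ∀ a b c f g h : ℤ, 0 < a → 0 < a * b - f ^ 2 →
    a * b * c + 2 * f * g * h - a * h ^ 2 - b * g ^ 2 - c * f ^ 2 = 1 →
    a + (a * b - f ^ 2) ≤ n → ∀ x y z, ∃ u v w, a * x ^ 2 + b * y ^ 2 + c * z ^ 2 +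
      2 * f * x * y + 2 * g * x * z + 2 * h * y * z = u ^ 2 + v ^ 2 + w ^ 2 := by
  have bal (f : ℤ) {a : ℤ} (ha : 0 < a) : ∃ k, 4 * (f + k * a) ^ 2 ≤ a ^ 2 := by
    refine ⟨-((2 * f + a) / (2 * a)), ?_⟩
    have h1 := Int.emod_add_mul_ediv (2 * f + a) (2 * a)
    have h2 := Int.emod_nonneg (2 * f + a) (show 2 * a ≠ 0 by omega)
    have h3 := Int.emod_lt_of_pos (2 * f + a) (show 0 < 2 * a by omega)
    have : (2 * (f + -((2 * f + a) / (2 * a)) * a)) ^ 2 ≤ a ^ 2 :=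
      sq_le_sq' (by linarith) (by linarith)
    linarith
  induction n with
  | zero => intro a b c f g h ha hD _ hn; push_cast at hn; omega
  | succ n ih =>
    intro a b c f g h ha hD hdet hn x y z
    push_cast at hn
    by_cases h1 : 4 * (a * b - f ^ 2) < 3 * a ^ 2
    · obtain ⟨k, hk⟩ := bal f ha
      have hb : a * (b + 2 * k * f + k ^ 2 * a) = (a * b - f ^ 2) + (f + k * a) ^ 2 := by ring
      have hb0 : 0 < b + 2 * k * f + k ^ 2 * a :=
        pos_of_mul_pos_right (a := a) (by rw [hb]; positivity) ha.le
      have hba : b + 2 * k * f + k ^ 2 * a < a := by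
        refine lt_of_mul_lt_mul_left (a := a) ?_ ha.le
        rw [hb]; linarith
      obtain ⟨u, v, w, H⟩ := ih (b + 2 * k * f + k ^ 2 * a) a c (f + k * a) (h + k * g) g hb0
        (by linarith) (by linear_combination hdet) (by linarith) y (x - k * y) z
      exact ⟨u, v, w, by linear_combination H⟩
    by_cases h2 : 4 * a < 3 * (a * b - f ^ 2) ^ 2
    · obtain ⟨k, hk⟩ := bal (a * h - f * g) hD
      have hT : (a * b - f ^ 2) * (a * (c + 2 * k * h + k ^ 2 * b) - (g + k * f) ^ 2) =
          a + (a * h - f * g + k * (a * b - f ^ 2)) ^ 2 := by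
        linear_combination a * hdet
      have hT0 : 0 < a * (c + 2 * k * h + k ^ 2 * b) - (g + k * f) ^ 2 :=
        pos_of_mul_pos_right (a := a * b - f ^ 2) (by rw [hT]; positivity) hD.le
      have hTD : a * (c + 2 * k * h + k ^ 2 * b) - (g + k * f) ^ 2 < a * b - f ^ 2 := by
        refine lt_of_mul_lt_mul_left (a := a * b - f ^ 2) ?_ hD.le
        rw [hT]; linarith
      obtain ⟨u, v, w, H⟩ := ih a (c + 2 * k * h + k ^ 2 * b) b (g + k * f) f (h + k * b) ha hT0
        (by linear_combination hdet) (by linarith) x z (y - k * z)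
      exact ⟨u, v, w, by linear_combination H⟩
    have ha1 : a = 1 := by
      by_contra hne
      have h3 : 2 ≤ a := by omega
      have h4 : (3 * a ^ 2) ^ 2 ≤ (4 * (a * b - f ^ 2)) ^ 2 :=
        pow_le_pow_left₀ (by positivity) (by linarith) 2
      have h5 : 27 * a ^ 4 ≤ 64 * a := by nlinarith
      have h6 : 8 ≤ a ^ 3 := by nlinarith [pow_le_pow_left₀ (by norm_num) h3 3]
      nlinarith
    subst ha1
    have hD1 : 1 * b - f ^ 2 = 1 := by nlinarith
    have hb : b = 1 + f ^ 2 := by linarith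
    subst hb
    exact ⟨x + f * y + g * z, y + (h - f * g) * z, z, by linear_combination z ^ 2 * hdet⟩

lemma exists_sq_add_dvd_prime {b p : ℕ} [Fact p.Prime] (hb : b % 4 = 1) (hp : p % 4 = 1)
    (hbp : b ∣ p + 1) : ∃ t : ℤ, (p : ℤ) ∣ t ^ 2 + b := by
  have h1 : jacobiSym p b = 1 := by
    have : ((p : ℤ) : ℤ) % b = -1 % b := by
      rw [← Int.ModEq, Int.modEq_comm, Int.modEq_iff_dvd, sub_neg_eq_add]
      exact_mod_cast hbp
    rw [jacobiSym.mod_left' this, jacobiSym.at_neg_one (Nat.odd_iff.mpr (by omega)),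
      ZMod.χ₄_nat_one_mod_four hb]
  have h2 : legendreSym p b = 1 := by
    rw [jacobiSym.legendreSym.to_jacobiSym,
      jacobiSym.quadratic_reciprocity_one_mod_four hb (Nat.odd_iff.mpr (by omega)), h1]
  have h3 : ((b : ℤ) : ZMod p) ≠ 0 := by
    intro h
    rw [(legendreSym.eq_zero_iff p b).mpr h] at h2
    exact zero_ne_one h2
  have h4 : IsSquare (-1 : ZMod p) := ZMod.exists_sq_eq_neg_one_iff.mpr (by omega)
  obtain ⟨t, ht⟩ := h4.mul ((legendreSym.eq_one_iff p h3).mp h2)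
  obtain ⟨t, rfl⟩ := ZMod.intCast_surjective t
  refine ⟨t, ?_⟩
  rw [← ZMod.intCast_zmod_eq_zero_iff_dvd]
  push_cast at ht ⊢
  linear_combination -ht

/-- Positive integers congruent to two modulo four are sums of three squares. -/
lemma exists_sum_three_squares {m : ℕ} (hm : m % 4 = 2) :
    ∃ u v w : ℤ, (m : ℤ) = u ^ 2 + v ^ 2 + w ^ 2 := by
  have hcop : Nat.Coprime (m - 1) (4 * m) := by
    refine Nat.Coprime.mul_right ?_ ?_
    · rw [show 4 = 2 ^ 2 by norm_num]
      exact (Nat.coprime_two_right.mpr (Nat.odd_iff.mpr (by omega))).pow_right 2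
    · rw [Nat.coprime_self_sub_left (by omega)]
      exact Nat.coprime_one_left m
  obtain ⟨p, hpm, hp, hpe⟩ := Nat.forall_exists_prime_gt_and_modEq m (by omega) hcop
  obtain ⟨v, hv⟩ := (Nat.modEq_iff_dvd' (by omega : m - 1 ≤ p)).mp hpe.symm
  have hpv : p + 1 = (4 * v + 1) * m := by
    have : p = m - 1 + 4 * m * v := by omega
    rw [this]
    have : m - 1 + 1 = m := by omega
    linarith
  have := Fact.mk hp
  have hp4 : p % 4 = 1 := by
    rw [show p = m - 1 + 4 * (m * v) by linarith [show p = m - 1 + 4 * m * v by omega]]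
    omega
  obtain ⟨t, a, ha⟩ := exists_sq_add_dvd_prime (b := 4 * v + 1) (p := p) (by omega) hp4
    ⟨m, hpv⟩
  have hp0 : (0 : ℤ) < p := by exact_mod_cast hp.pos
  have hdet : (p : ℤ) + 1 = (4 * v + 1) * m := by exact_mod_cast hpv
  push_cast at ha
  have hpos : (0 : ℤ) < a * p - t ^ 2 := by
    rw [show a * p - t ^ 2 = 4 * v + 1 by linear_combination -ha]
    positivity
  obtain ⟨x, y, z, h⟩ := ternary_eq_sum_three_squares (a + (a * p - t ^ 2)).toNat a p m t 1 0
    (pos_of_mul_pos_left (b := (p : ℤ)) (by nlinarith [sq_nonneg t]) hp0.le) hpos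
    (by linear_combination -m * ha - hdet) (Int.self_le_toNat _) 0 0 1
  exact ⟨x, y, z, by linear_combination h⟩

def quadrupleEquivFourZero : ℤ × ℤ × ℤ × ℤ ≃ (Fin 4 → ℤ) × (Fin 0 → ℤ) where
  toFun v := (![v.1, v.2.1, v.2.2.1, v.2.2.2], ![])
  invFun p := (p.1 0, p.1 1, p.1 2, p.1 3)
  left_inv v := by simp
  right_inv p := by
    refine Prod.ext ?_ (Subsingleton.elim _ _)
    ext i
    fin_cases i <;> rfl

def quadrupleEquivThreeOne : ℤ × ℤ × ℤ × ℤ ≃ (Fin 3 → ℤ) × (Fin 1 → ℤ) where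
  toFun v := (![v.1, v.2.1, v.2.2.1], ![v.2.2.2])
  invFun p := (p.1 0, p.1 1, p.1 2, p.2 0)
  left_inv v := by simp
  right_inv p := by
    refine Prod.ext ?_ ?_
    · ext i
      fin_cases i <;> rfl
    · ext i
      fin_cases i
      rfl

/-- Quadruples of integers representing `m` by `x² + y² + z² + d w²`. -/
def quadruples (d m : ℤ) : Set (ℤ × ℤ × ℤ × ℤ) :=
  {v | v.1 ^ 2 + v.2.1 ^ 2 + v.2.2.1 ^ 2 + d * v.2.2.2 ^ 2 = m}

/-- Quadruples of odd integers. -/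
def oddQuadruples : Set (ℤ × ℤ × ℤ × ℤ) :=
  {v | Odd v.1 ∧ Odd v.2.1 ∧ Odd v.2.2.1 ∧ Odd v.2.2.2}

lemma quadForm_quadrupleEquivFourZero (v : ℤ × ℤ × ℤ × ℤ) :
    quadForm 4 0 (quadrupleEquivFourZero v) =
      v.1 ^ 2 + v.2.1 ^ 2 + v.2.2.1 ^ 2 + 1 * v.2.2.2 ^ 2 := by
  simp [quadForm, quadrupleEquivFourZero, Fin.sum_univ_four]

lemma quadForm_quadrupleEquivThreeOne (v : ℤ × ℤ × ℤ × ℤ) :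
    quadForm 3 1 (quadrupleEquivThreeOne v) =
      v.1 ^ 2 + v.2.1 ^ 2 + v.2.2.1 ^ 2 + 3 * v.2.2.2 ^ 2 := by
  simp [quadForm, quadrupleEquivThreeOne, Fin.sum_univ_three]

lemma finite_quadruples_one (m : ℤ) : (quadruples 1 m).Finite := by
  refine ((finite_quadForm_eq 4 0 m).preimage quadrupleEquivFourZero.injective.injOn).subset
    fun v hv => ?_
  rw [Set.mem_preimage, Set.mem_ofPred_eq, quadForm_quadrupleEquivFourZero]
  exact hv

lemma finite_quadruples_three (m : ℤ) : (quadruples 3 m).Finite := by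
  refine ((finite_quadForm_eq 3 1 m).preimage quadrupleEquivThreeOne.injective.injOn).subset
    fun v hv => ?_
  rw [Set.mem_preimage, Set.mem_ofPred_eq, quadForm_quadrupleEquivThreeOne]
  exact hv

lemma N_four_zero (m : ℤ) : N 4 0 m = (quadruples 1 m).ncard := by
  rw [N_eq_ncard, ← Set.ncard_preimage_of_injective_subset_range
    quadrupleEquivFourZero.injective (by simp [quadrupleEquivFourZero.surjective.range_eq])]
  congr 1
  ext v
  rw [Set.mem_preimage, Set.mem_ofPred_eq, quadForm_quadrupleEquivFourZero]
  rfl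

lemma N_three_one (m : ℤ) : N 3 1 m = (quadruples 3 m).ncard := by
  rw [N_eq_ncard, ← Set.ncard_preimage_of_injective_subset_range
    quadrupleEquivThreeOne.injective (by simp [quadrupleEquivThreeOne.surjective.range_eq])]
  congr 1
  ext v
  rw [Set.mem_preimage, Set.mem_ofPred_eq, quadForm_quadrupleEquivThreeOne]
  rfl

lemma Nstar_four_zero (m : ℤ) :
    Nstar 4 0 m = (quadruples 1 m ∩ oddQuadruples).ncard := by
  rw [Nstar_eq_ncard, ← Set.ncard_preimage_of_injective_subset_range
    quadrupleEquivFourZero.injective (by simp [quadrupleEquivFourZero.surjective.range_eq])]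
  congr 1
  ext v
  rw [Set.mem_preimage, Set.mem_ofPred_eq, quadForm_quadrupleEquivFourZero, and_comm]
  simp [quadruples, oddQuadruples, quadrupleEquivFourZero, Fin.forall_fin_succ]

lemma Nstar_three_one (m : ℤ) :
    Nstar 3 1 m = (quadruples 3 m ∩ oddQuadruples).ncard := by
  rw [Nstar_eq_ncard, ← Set.ncard_preimage_of_injective_subset_range
    quadrupleEquivThreeOne.injective (by simp [quadrupleEquivThreeOne.surjective.range_eq])]
  congr 1
  ext v
  rw [Set.mem_preimage, Set.mem_ofPred_eq, quadForm_quadrupleEquivThreeOne, and_comm]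
  simp [quadruples, oddQuadruples, quadrupleEquivThreeOne, Fin.forall_fin_succ, and_assoc]

lemma sq_emod_eight (x : ℤ) : (Odd x ∧ x ^ 2 % 8 = 1) ∨
    (Even x ∧ x ^ 2 % 4 = 0) := by
  rcases Int.even_or_odd x with h | h
  · right
    obtain ⟨k, rfl⟩ := h
    refine ⟨⟨k, rfl⟩, ?_⟩
    rw [show (k + k) ^ 2 = 4 * k ^ 2 by ring]
    omega
  · refine Or.inl ⟨h, ?_⟩
    obtain ⟨k, rfl⟩ := h
    obtain ⟨j, hj⟩ := Int.even_mul_succ_self k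
    rw [show (2 * k + 1) ^ 2 = 4 * (k * (k + 1)) + 1 by ring, hj]
    omega

lemma two_mul_N_four_zero {m : ℤ} (hm : 8 ∣ m - 4) : 2 * N 4 0 m = 3 * Nstar 4 0 m := by
  obtain ⟨u, rfl⟩ : ∃ u, m = 4 * u := ⟨m / 4, by omega⟩
  have hfin := finite_quadruples_one u
  have hQ := finite_quadruples_one (4 * u)
  set f₁ : ℤ × ℤ × ℤ × ℤ → ℤ × ℤ × ℤ × ℤ := fun v =>
    (v.1 - v.2.1 - v.2.2.1 - v.2.2.2, v.2.1 - v.1 - v.2.2.1 - v.2.2.2,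
      v.2.2.1 - v.1 - v.2.1 - v.2.2.2, v.2.2.2 - v.1 - v.2.1 - v.2.2.1) with hf₁
  set f₂ : ℤ × ℤ × ℤ × ℤ → ℤ × ℤ × ℤ × ℤ := fun v =>
    (v.2.1 + v.2.2.1 + v.2.2.2 - v.1, v.2.1 - v.1 - v.2.2.1 - v.2.2.2,
      v.2.2.1 - v.1 - v.2.1 - v.2.2.2, v.2.2.2 - v.1 - v.2.1 - v.2.2.1) with hf₂
  set f₃ : ℤ × ℤ × ℤ × ℤ → ℤ × ℤ × ℤ × ℤ := fun v =>
    (2 * v.1, 2 * v.2.1, 2 * v.2.2.1, 2 * v.2.2.2) with hf₃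
  have hi₁ : Function.Injective f₁ := by
    rintro ⟨x, y, z, w⟩ ⟨x', y', z', w'⟩ h
    simp only [hf₁, Prod.mk.injEq] at h ⊢
    omega
  have hi₂ : Function.Injective f₂ := by
    rintro ⟨x, y, z, w⟩ ⟨x', y', z', w'⟩ h
    simp only [hf₂, Prod.mk.injEq] at h ⊢
    omega
  have hi₃ : Function.Injective f₃ := by
    rintro ⟨x, y, z, w⟩ ⟨x', y', z', w'⟩ h
    simp only [hf₃, Prod.mk.injEq] at h ⊢
    omega
  have hpar : ∀ v ∈ quadruples 1 u, Odd (v.1 + v.2.1 + v.2.2.1 + v.2.2.2) := by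
    rintro ⟨x, y, z, w⟩ hv
    simp only [quadruples, Set.mem_ofPred_eq] at hv
    have : Odd u := by rw [Int.odd_iff]; omega
    rw [← hv] at this
    simp only [Int.odd_add, Int.odd_pow, parity_simps] at this ⊢
    grind
  have hodd : quadruples 1 (4 * u) ∩ oddQuadruples =
      f₁ '' quadruples 1 u ∪ f₂ '' quadruples 1 u := by
    apply Set.Subset.antisymm
    · rintro ⟨x, y, z, w⟩ ⟨hv, ⟨x, rfl⟩, ⟨y, rfl⟩, ⟨z, rfl⟩, ⟨w, rfl⟩⟩
      simp only [quadruples, Set.mem_ofPred_eq] at hv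
      rcases Int.even_or_odd' (x + y + z + w) with ⟨k, hk | hk⟩
      · right
        obtain rfl : w = 2 * k - x - y - z := by omega
        refine ⟨(-k - 1, y - k + x, z - k + x, k - y - z), ?_, ?_⟩
        · simp only [quadruples, Set.mem_ofPred_eq]
          linarith
        · simp only [hf₂, Prod.mk.injEq]
          refine ⟨?_, ?_, ?_, ?_⟩ <;> ring
      · left
        obtain rfl : w = 2 * k + 1 - x - y - z := by omega
        refine ⟨(x - k - 1, y - k - 1, z - k - 1, k - x - y - z), ?_, ?_⟩
        · simp only [quadruples, Set.mem_ofPred_eq]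
          linarith
        · simp only [hf₁, Prod.mk.injEq]
          refine ⟨?_, ?_, ?_, ?_⟩ <;> ring
    · rintro v (⟨⟨x, y, z, w⟩, hv, rfl⟩ | ⟨⟨x, y, z, w⟩, hv, rfl⟩)
      · have hp := hpar _ hv
        simp only [quadruples, Set.mem_ofPred_eq] at hv
        simp only [hf₁]
        refine ⟨?_, ?_⟩
        · simp only [quadruples, Set.mem_ofPred_eq]
          linear_combination 4 * hv
        · simp only [oddQuadruples, Set.mem_ofPred_eq]
          grind
      · have hp := hpar _ hv
        simp only [quadruples, Set.mem_ofPred_eq] at hv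
        simp only [hf₂]
        refine ⟨?_, ?_⟩
        · simp only [quadruples, Set.mem_ofPred_eq]
          linear_combination 4 * hv
        · simp only [oddQuadruples, Set.mem_ofPred_eq]
          grind
  have heven : quadruples 1 (4 * u) \ oddQuadruples = f₃ '' quadruples 1 u := by
    apply Set.Subset.antisymm
    · rintro ⟨x, y, z, w⟩ ⟨hv, ho⟩
      simp only [quadruples, Set.mem_ofPred_eq] at hv
      simp only [oddQuadruples, Set.mem_ofPred_eq] at ho
      have : Even x ∧ Even y ∧ Even z ∧ Even w := by
        rcases sq_emod_eight x with h1 | h1 <;> rcases sq_emod_eight y with h2 | h2 <;>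
          rcases sq_emod_eight z with h3 | h3 <;> rcases sq_emod_eight w with h4 | h4 <;>
          first
          | exact ⟨h1.1, h2.1, h3.1, h4.1⟩
          | exact (ho ⟨h1.1, h2.1, h3.1, h4.1⟩).elim
          | omega
      obtain ⟨⟨x, rfl⟩, ⟨y, rfl⟩, ⟨z, rfl⟩, ⟨w, rfl⟩⟩ := this
      refine ⟨(x, y, z, w), ?_, by simp [hf₃, two_mul]⟩
      simp only [quadruples, Set.mem_ofPred_eq]
      linarith
    · rintro v ⟨⟨x, y, z, w⟩, hv, rfl⟩
      simp only [quadruples, Set.mem_ofPred_eq] at hv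
      refine ⟨?_, ?_⟩
      · simp only [quadruples, hf₃, Set.mem_ofPred_eq]
        linear_combination 4 * hv
      · simp [oddQuadruples, hf₃]
  have hdisj : Disjoint (f₁ '' quadruples 1 u) (f₂ '' quadruples 1 u) := by
    rw [Set.disjoint_left]
    rintro v ⟨⟨x, y, z, w⟩, hv, rfl⟩ ⟨⟨x', y', z', w'⟩, hv', h⟩
    obtain ⟨k, hk⟩ := hpar _ hv
    obtain ⟨l, hl⟩ := hpar _ hv'
    simp only [hf₁, hf₂, Prod.mk.injEq] at h hk hl
    omega
  have h1 : Nstar 4 0 (4 * u) = 2 * (quadruples 1 u).ncard := by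
    rw [Nstar_four_zero, hodd, Set.ncard_union_eq hdisj (hfin.image _) (hfin.image _),
      Set.ncard_image_of_injective _ hi₁, Set.ncard_image_of_injective _ hi₂, two_mul]
  have h2 : N 4 0 (4 * u) = 3 * (quadruples 1 u).ncard := by
    rw [N_four_zero, ← Set.ncard_inter_add_ncard_sdiff_eq_ncard _ oddQuadruples hQ,
      ← Nstar_four_zero, h1, heven, Set.ncard_image_of_injective _ hi₃]
    ring
  rw [h1, h2]
  ring

lemma two_mul_N_three_one {m : ℤ} (hm : 8 ∣ m - 6) : 2 * N 3 1 m = 5 * Nstar 3 1 m := by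
  have hQ := finite_quadruples_three m
  set E : Set (ℤ × ℤ × ℤ × ℤ) :=
    {v | 4 * v.1 ^ 2 + v.2.1 ^ 2 + v.2.2.1 ^ 2 + 12 * v.2.2.2 ^ 2 = m} with hE
  set f₁ : ℤ × ℤ × ℤ × ℤ → ℤ × ℤ × ℤ × ℤ := fun v =>
    (v.1 + 3 * v.2.2.2, v.2.1, v.2.2.1, v.1 - v.2.2.2) with hf₁
  set f₂ : ℤ × ℤ × ℤ × ℤ → ℤ × ℤ × ℤ × ℤ := fun v =>
    (v.1 + 3 * v.2.2.2, v.2.1, v.2.2.1, v.2.2.2 - v.1) with hf₂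
  set f₃ : ℤ × ℤ × ℤ × ℤ → ℤ × ℤ × ℤ × ℤ := fun v =>
    (2 * v.1, v.2.1, v.2.2.1, 2 * v.2.2.2) with hf₃
  set f₄ : ℤ × ℤ × ℤ × ℤ → ℤ × ℤ × ℤ × ℤ := fun v =>
    (v.2.1, 2 * v.1, v.2.2.1, 2 * v.2.2.2) with hf₄
  set f₅ : ℤ × ℤ × ℤ × ℤ → ℤ × ℤ × ℤ × ℤ := fun v =>
    (v.2.1, v.2.2.1, 2 * v.1, 2 * v.2.2.2) with hf₅
  have hi₁ : Function.Injective f₁ := by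
    rintro ⟨x, y, z, w⟩ ⟨x', y', z', w'⟩ h
    simp only [hf₁, Prod.mk.injEq] at h ⊢
    omega
  have hi₂ : Function.Injective f₂ := by
    rintro ⟨x, y, z, w⟩ ⟨x', y', z', w'⟩ h
    simp only [hf₂, Prod.mk.injEq] at h ⊢
    omega
  have hi₃ : Function.Injective f₃ := by
    rintro ⟨x, y, z, w⟩ ⟨x', y', z', w'⟩ h
    simp only [hf₃, Prod.mk.injEq] at h ⊢
    omega
  have hi₄ : Function.Injective f₄ := by
    rintro ⟨x, y, z, w⟩ ⟨x', y', z', w'⟩ h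
    simp only [hf₄, Prod.mk.injEq] at h ⊢
    omega
  have hi₅ : Function.Injective f₅ := by
    rintro ⟨x, y, z, w⟩ ⟨x', y', z', w'⟩ h
    simp only [hf₅, Prod.mk.injEq] at h ⊢
    omega
  have hpar : ∀ v ∈ E, Odd v.2.1 ∧ Odd v.2.2.1 ∧ Odd (v.1 + v.2.2.2) := by
    rintro ⟨x, y, z, w⟩ hv
    simp only [hE, Set.mem_ofPred_eq] at hv
    rw [Int.odd_add]
    rcases sq_emod_eight y with h2 | h2 <;> rcases sq_emod_eight z with h3 | h3 <;>
      rcases sq_emod_eight x with h1 | h1 <;> rcases sq_emod_eight w with h4 | h4 <;>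
      first
      | omega
      | exact ⟨h2.1, h3.1, iff_of_true h1.1 h4.1⟩
      | exact ⟨h2.1, h3.1, iff_of_false (Int.not_odd_iff_even.mpr h1.1)
          (Int.not_even_iff_odd.mpr h4.1)⟩
  have hodd : quadruples 3 m ∩ oddQuadruples = f₁ '' E ∪ f₂ '' E := by
    apply Set.Subset.antisymm
    · rintro ⟨x, y, z, w⟩ ⟨hv, ⟨x, rfl⟩, hy, hz, ⟨w, rfl⟩⟩
      simp only [quadruples, Set.mem_ofPred_eq] at hv
      rcases Int.even_or_odd' (x - w) with ⟨k, hk | hk⟩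
      · left
        obtain rfl : x = 2 * k + w := by omega
        refine ⟨(2 * w + 1 + k, y, z, k), ?_, ?_⟩
        · simp only [hE, Set.mem_ofPred_eq]
          linarith
        · simp only [hf₁, Prod.mk.injEq]
          refine ⟨?_, trivial, trivial, ?_⟩ <;> ring
      · right
        obtain rfl : x = 2 * k + 1 + w := by omega
        refine ⟨(k - w, y, z, w + k + 1), ?_, ?_⟩
        · simp only [hE, Set.mem_ofPred_eq]
          linarith
        · simp only [hf₂, Prod.mk.injEq]
          refine ⟨?_, trivial, trivial, ?_⟩ <;> ring
    · rintro v (⟨⟨x, y, z, w⟩, hv, rfl⟩ | ⟨⟨x, y, z, w⟩, hv, rfl⟩)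
      all_goals
        obtain ⟨h1, h2, h3⟩ := hpar _ hv
        simp only [hE, Set.mem_ofPred_eq] at hv
        simp only [hf₁, hf₂]
        refine ⟨?_, ?_, h1, h2, ?_⟩
        · simp only [quadruples, Set.mem_ofPred_eq]
          linear_combination hv
        · simp only at h3 ⊢
          grind
        · simp only at h3 ⊢
          grind
  have heven : quadruples 3 m \ oddQuadruples = f₃ '' E ∪ (f₄ '' E ∪ f₅ '' E) := by
    apply Set.Subset.antisymm
    · rintro ⟨x, y, z, w⟩ ⟨hv, ho⟩
      simp only [quadruples, Set.mem_ofPred_eq] at hv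
      simp only [oddQuadruples, Set.mem_ofPred_eq] at ho
      have : Even w ∧ (Even x ∨ Even y ∨ Even z) := by
        rcases sq_emod_eight x with h1 | h1 <;> rcases sq_emod_eight y with h2 | h2 <;>
          rcases sq_emod_eight z with h3 | h3 <;> rcases sq_emod_eight w with h4 | h4 <;>
          first
          | exact ⟨h4.1, Or.inl h1.1⟩
          | exact ⟨h4.1, Or.inr (Or.inl h2.1)⟩
          | exact ⟨h4.1, Or.inr (Or.inr h3.1)⟩
          | exact (ho ⟨h1.1, h2.1, h3.1, h4.1⟩).elim
          | omega
      obtain ⟨⟨w, rfl⟩, ⟨x, rfl⟩ | ⟨y, rfl⟩ | ⟨z, rfl⟩⟩ := this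
      · refine Or.inl ⟨(x, y, z, w), ?_, by simp [hf₃, two_mul]⟩
        simp only [hE, Set.mem_ofPred_eq]
        linear_combination hv
      · refine Or.inr (Or.inl ⟨(y, x, z, w), ?_, by simp [hf₄, two_mul]⟩)
        simp only [hE, Set.mem_ofPred_eq]
        linear_combination hv
      · refine Or.inr (Or.inr ⟨(z, x, y, w), ?_, by simp [hf₅, two_mul]⟩)
        simp only [hE, Set.mem_ofPred_eq]
        linear_combination hv
    · rintro v (⟨⟨x, y, z, w⟩, hv, rfl⟩ | ⟨⟨x, y, z, w⟩, hv, rfl⟩ | ⟨⟨x, y, z, w⟩, hv, rfl⟩)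
      all_goals
        simp only [hE, Set.mem_ofPred_eq] at hv
        refine ⟨?_, ?_⟩
        · simp only [quadruples, hf₃, hf₄, hf₅, Set.mem_ofPred_eq]
          linear_combination hv
        · simp [oddQuadruples, hf₃, hf₄, hf₅]
  have hdisj₁ : Disjoint (f₁ '' E) (f₂ '' E) := by
    rw [Set.disjoint_left]
    rintro v ⟨⟨x, y, z, w⟩, hv, rfl⟩ ⟨⟨x', y', z', w'⟩, hv', h⟩
    obtain ⟨-, -, k, hk⟩ := hpar _ hv
    obtain ⟨-, -, l, hl⟩ := hpar _ hv'
    simp only [hf₁, hf₂, Prod.mk.injEq] at h hk hl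
    omega
  have hdisj₂ : Disjoint (f₄ '' E) (f₅ '' E) := by
    rw [Set.disjoint_left]
    rintro v ⟨⟨x, y, z, w⟩, hv, rfl⟩ ⟨⟨x', y', z', w'⟩, hv', h⟩
    obtain ⟨l, hl⟩ := (hpar _ hv').2.1
    simp only [hf₄, hf₅, Prod.mk.injEq] at h hl
    omega
  have hdisj₃ : Disjoint (f₃ '' E) (f₄ '' E ∪ f₅ '' E) := by
    rw [Set.disjoint_left]
    rintro v ⟨⟨x, y, z, w⟩, hv, rfl⟩ (⟨⟨x', y', z', w'⟩, hv', h⟩ | ⟨⟨x', y', z', w'⟩, hv', h⟩)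
    all_goals
      obtain ⟨l, hl⟩ := (hpar _ hv').1
      simp only [hf₃, hf₄, hf₅, Prod.mk.injEq] at h hl
      omega
  have hfin : E.Finite := by
    have : (f₃ '' E).Finite := hQ.subset fun v hv => by
      have h : v ∈ quadruples 3 m \ oddQuadruples := heven ▸ Or.inl hv
      exact h.1
    exact this.of_finite_image hi₃.injOn
  have h1 : Nstar 3 1 m = 2 * E.ncard := by
    rw [Nstar_three_one, hodd, Set.ncard_union_eq hdisj₁ (hfin.image _) (hfin.image _),
      Set.ncard_image_of_injective _ hi₁, Set.ncard_image_of_injective _ hi₂, two_mul]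
  have h2 : N 3 1 m = 5 * E.ncard := by
    rw [N_three_one, ← Set.ncard_inter_add_ncard_sdiff_eq_ncard _ oddQuadruples hQ,
      ← Nstar_three_one, h1, heven,
      Set.ncard_union_eq hdisj₃ (hfin.image _) ((hfin.image _).union (hfin.image _)),
      Set.ncard_union_eq hdisj₂ (hfin.image _) (hfin.image _),
      Set.ncard_image_of_injective _ hi₃, Set.ncard_image_of_injective _ hi₄,
      Set.ncard_image_of_injective _ hi₅]
    ring
  rw [h1, h2]
  ring

lemma N_three_one_pos {m : ℤ} (hm : 0 < m) (h : 8 ∣ m - 6) : 0 < N 3 1 m := by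
  lift m to ℕ using hm.le
  obtain ⟨u, v, w, huvw⟩ := exists_sum_three_squares (m := m) (by omega)
  rw [N_three_one, Set.ncard_pos (finite_quadruples_three _)]
  refine ⟨(u, v, w, 0), ?_⟩
  simp only [quadruples, Set.mem_ofPred_eq]
  linear_combination -huvw

lemma limitRatio_four_zero : limitRatio 4 0 = 2 / 3 := by
  have : Real.pi * ((4 : ℕ) + 3 * (0 : ℕ)) / 4 = Real.pi := by push_cast; ring
  rw [limitRatio, this, Real.cos_pi]
  norm_num

lemma limitRatio_three_one : limitRatio 3 1 = 2 / 5 := by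
  have : Real.pi * ((3 : ℕ) + 3 * (1 : ℕ)) / 4 = Real.pi / 2 + Real.pi := by push_cast; ring
  rw [limitRatio, this, Real.cos_add_pi, Real.cos_pi_div_two]
  norm_num

lemma N_four_zero_pos_eventually : ∃ M : ℤ, ∀ m, M ≤ m → 8 ∣ m - 4 → 0 < N 4 0 m := by
  obtain ⟨c, hc, M, hM⟩ := growsOn_Nstar_four_zero
  refine ⟨max M 1, fun m hm h8 => ?_⟩
  have h1 : (0 : ℝ) < m := by exact_mod_cast (le_max_right M 1).trans hm
  have h2 := hM m ((le_max_left M 1).trans hm) h8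
  have h3 : (0 : ℝ) < Nstar 4 0 m := lt_of_lt_of_le (by positivity) h2
  exact lt_of_lt_of_le (by exact_mod_cast h3) (Nstar_le_N 4 0 m)

lemma tendsto_ratio_of_eventually_eq {a b : ℕ} {L : ℝ} {M : ℤ}
    (h : ∀ m : ℤ, M ≤ m → 8 ∣ m - (a + 3 * b : ℕ) → (Nstar a b m : ℝ) / N a b m = L) :
    Filter.Tendsto (fun n : ℕ =>
        (Nstar a b (8 * (n : ℤ) + a + 3 * b) : ℝ) / (N a b (8 * (n : ℤ) + a + 3 * b) : ℝ))
      Filter.atTop (nhds L) := by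
  refine tendsto_const_nhds.congr' ?_
  filter_upwards [Filter.eventually_ge_atTop M.toNat] with n hn
  exact (h _ (by omega) ⟨n, by push_cast; ring⟩).symm

lemma tendsto_ratio_of_six_le {a b : ℕ} (ha : 1 < a) (hpar : Even (a + b)) (hge : 6 ≤ a + b)
    (hmod : ¬ 8 ∣ a + 3 * b) :
    Filter.Tendsto (fun n : ℕ =>
        (Nstar a b (8 * (n : ℤ) + a + 3 * b) : ℝ) / (N a b (8 * (n : ℤ) + a + 3 * b) : ℝ))
      Filter.atTop (nhds (limitRatio a b)) := by
  obtain ⟨M, hM⟩ := exists_abs_Nstar_sub_le (by omega : a ≠ 0) hpar (by omega) hmod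
  obtain ⟨c, hc, M', hM'⟩ := growsOn_Nstar ha hpar hge
  have hab : (6 : ℝ) ≤ (a + b : ℕ) := by exact_mod_cast hge
  set e : ℝ := ((a + b : ℕ) : ℝ) / 4 - 4 / 3 with he
  have hepos : 0 < e := by rw [he]; linarith
  have htop : Filter.Tendsto (fun n : ℕ => (((8 * (n : ℤ) + a + 3 * b : ℤ) : ℝ))) Filter.atTop
      Filter.atTop := by
    refine Filter.tendsto_atTop_mono (fun n => ?_) tendsto_natCast_atTop_atTop
    have : (n : ℤ) ≤ 8 * (n : ℤ) + a + 3 * b := by omega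
    exact_mod_cast this
  have hlim := ((tendsto_rpow_neg_atTop hepos).comp htop).const_mul (M / c)
  rw [mul_zero] at hlim
  rw [tendsto_iff_dist_tendsto_zero]
  refine squeeze_zero' (Filter.Eventually.of_forall fun _ => dist_nonneg) ?_ hlim
  filter_upwards [Filter.eventually_ge_atTop M'.toNat] with n hn
  have hm : M' ≤ 8 * (n : ℤ) + a + 3 * b := by omega
  have hm0 : 0 < 8 * (n : ℤ) + a + 3 * b := by omega
  have h8 : (8 : ℤ) ∣ 8 * (n : ℤ) + a + 3 * b - (a + 3 * b : ℕ) := ⟨n, by push_cast; ring⟩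
  simp only [Function.comp]
  generalize 8 * (n : ℤ) + a + 3 * b = m at *
  have h1 := hM m hm0 h8
  have h2 := (hM' m hm h8).trans (by exact_mod_cast Nstar_le_N a b m : (_ : ℝ) ≤ N a b m)
  have hmR : (0 : ℝ) < m := by exact_mod_cast hm0
  have hN : (0 : ℝ) < N a b m := lt_of_lt_of_le (by positivity) h2
  rw [Real.dist_eq, show (Nstar a b m : ℝ) / N a b m - limitRatio a b =
    (Nstar a b m - limitRatio a b * N a b m) / N a b m by field_simp, abs_div, abs_of_pos hN,
    div_le_iff₀ hN]
  have hMn : 0 ≤ M * (m : ℝ) ^ ((a + b : ℕ) / 4 : ℝ) := (abs_nonneg _).trans h1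
  have hM0 : 0 ≤ M := nonneg_of_mul_nonneg_left hMn (by positivity)
  calc _ ≤ M * (m : ℝ) ^ ((a + b : ℕ) / 4 : ℝ) := h1
    _ = M / c * (m : ℝ) ^ (-e) * (c * (m : ℝ) ^ (((a + b : ℕ) : ℝ) / 2 - 4 / 3)) := by
        have : (m : ℝ) ^ ((a + b : ℕ) / 4 : ℝ) =
            (m : ℝ) ^ (-e) * (m : ℝ) ^ (((a + b : ℕ) : ℝ) / 2 - 4 / 3) := by
          rw [← Real.rpow_add hmR]
          congr 1
          rw [he]; ring
        rw [this]
        field_simp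
    _ ≤ M / c * (m : ℝ) ^ (-e) * N a b m :=
        mul_le_mul_of_nonneg_left h2 (by positivity)

theorem stmt_2 (a b : ℕ) (ha : 1 < a) (hpar : Even (a + b)) (hge : 4 ≤ a + b)
    (hmod : ¬ (8 ∣ a + 3 * b)) :
    Filter.Tendsto (fun n : ℕ =>
        (Nstar a b (8 * (n : ℤ) + a + 3 * b) : ℝ) / (N a b (8 * (n : ℤ) + a + 3 * b) : ℝ))
      Filter.atTop
      (nhds (2 / ((2 : ℝ) ^ (a + b - 2) +
        (-1 : ℝ) ^ b * 2 ^ ((a + b - 2) / 2) * Real.cos (Real.pi * (a + 3 * b) / 4) + 1))) := by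
  change Filter.Tendsto _ _ (nhds (limitRatio a b))
  by_cases h6 : 6 ≤ a + b
  · exact tendsto_ratio_of_six_le ha hpar h6 hmod
  have hab : a + b = 4 := by
    obtain ⟨k, hk⟩ := hpar
    omega
  obtain ⟨rfl, rfl⟩ | ⟨rfl, rfl⟩ : (a = 4 ∧ b = 0) ∨ (a = 3 ∧ b = 1) := by omega
  · obtain ⟨M, hM⟩ := N_four_zero_pos_eventually
    refine tendsto_ratio_of_eventually_eq (M := M) fun m hm h8 => ?_
    have h1 : (0 : ℝ) < N 4 0 m := by exact_mod_cast hM m hm h8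
    have h2 : (2 * N 4 0 m : ℝ) = 3 * Nstar 4 0 m := by exact_mod_cast two_mul_N_four_zero h8
    rw [limitRatio_four_zero, div_eq_div_iff h1.ne' (by norm_num)]
    linarith
  · refine tendsto_ratio_of_eventually_eq (M := 1) fun m hm h8 => ?_
    have h1 : (0 : ℝ) < N 3 1 m := by exact_mod_cast N_three_one_pos (by omega) h8
    have h2 : (2 * N 3 1 m : ℝ) = 5 * Nstar 3 1 m := by exact_mod_cast two_mul_N_three_one h8
    rw [limitRatio_three_one, div_eq_div_iff h1.ne' (by norm_num)]
    linarith
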